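/- arXiv:1507.07690 — 2 statements merged into one kernel-verified Lean document; each statement's English description precedes it below -/
import Mathlib

section
/- Let Q ⊆ [0,1] be countable with 1 ∈ Q and let (μ_t)_{t∈Q} be a family of probability measures on ℝ with finite first moments such that μ_s ⪯ μ_t in convex order whenever s ≤ t. Then for every finite D ⊆ Q with 1 ∈ D, the set M_Q((μ_t)_{t∈D}) of martingale measures P on ℝ^Q (with the product topology) satisfying S_t ∼_P μ_t for t ∈ D is nonempty and compact in the weak topology. Consequently M((μ_t)_{t∈Q}) = ⋂_{finite D} M_Q((μ_t)_{t∈D}) is nonempty and compact. -/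
open MeasureTheory Set

/-- The convex order on probability measures on `ℝ`. -/
def ConvexOrder (μ ν : Measure ℝ) : Prop :=
  ∀ φ : ℝ → ℝ, ConvexOn ℝ Set.univ φ → Integrable φ μ → Integrable φ ν →
    ∫ x, φ x ∂μ ≤ ∫ x, φ x ∂ν

/-- The natural filtration of the canonical (coordinate) process on `ℝ^Q`. -/
noncomputable def natFiltration (Q : Type*) [Preorder Q] :
    Filtration Q (MeasurableSpace.pi : MeasurableSpace (Q → ℝ)) where
  seq i := ⨆ t ∈ Set.Iic i, MeasurableSpace.comap (fun ω : Q → ℝ => ω t) inferInstance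
  mono' i j hij := by
    refine iSup_le fun t => iSup_le fun ht => ?_
    exact le_iSup₂ (f := fun (t : Q) (_ : t ∈ Set.Iic j) =>
      MeasurableSpace.comap (fun ω : Q → ℝ => ω t) inferInstance) t (ht.trans hij)
  le' i := by
    refine iSup_le fun t => iSup_le fun _ => ?_
    exact (measurable_pi_apply t).comap_le

/-- The set of martingale measures on `ℝ^Q` (for the natural filtration of the canonical
process) whose marginal at each time `t ∈ D` is `μ t`. -/
def MQ (Q : Set ℝ) (D : Set ↥Q) (μ : ↥Q → ProbabilityMeasure ℝ) :
    Set (ProbabilityMeasure (↥Q → ℝ)) :=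
  {P | Martingale (fun (t : ↥Q) (ω : ↥Q → ℝ) => ω t) (natFiltration ↥Q)
        (P : Measure (↥Q → ℝ)) ∧
       ∀ t ∈ D, (P : Measure (↥Q → ℝ)).map (fun ω => ω t) = (μ t : Measure ℝ)}


set_option linter.unusedSectionVars false
set_option linter.unusedVariables false
open Filter Topology
open scoped BoundedContinuousFunction ENNReal NNReal

/-- The potential function of a measure on the line. -/
noncomputable def pot (ν : Measure ℝ) (z : ℝ) : ℝ := ∫ x, |x - z| ∂ν

/-- Measures all of whose one-dimensional potentials are dominated by that of `ν`. -/
def GG (I : Type*) (ν : Measure ℝ) : Set (ProbabilityMeasure (I → ℝ)) :=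
  {P | ∀ t : I, Integrable (fun ω : I → ℝ => ω t) (P : Measure (I → ℝ)) ∧
    ∀ z : ℝ, ∫ ω, |ω t - z| ∂(P : Measure (I → ℝ)) ≤ pot ν z}

section compactness

variable {I : Type*} [Countable I] {ν : Measure ℝ} [IsProbabilityMeasure ν]

lemma pot_nonneg (ν : Measure ℝ) (z : ℝ) : 0 ≤ pot ν z :=
  integral_nonneg fun _ => abs_nonneg _

lemma GG_tight (ν : Measure ℝ) :
    IsTightMeasureSet {((P : ProbabilityMeasure (I → ℝ)) : Measure (I → ℝ)) | P ∈ GG I ν} := by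
  rw [isTightMeasureSet_iff_exists_isCompact_measure_compl_le]
  intro ε hε
  obtain ⟨δ, hδ, hδs⟩ := ENNReal.exists_pos_sum_of_countable hε.ne' I
  set C : ℝ := pot ν 0 + 1
  have hC : 0 < C := by have := pot_nonneg ν 0; positivity
  refine ⟨Set.pi univ fun t => Icc (-(C / δ t)) (C / δ t),
    isCompact_univ_pi fun t => isCompact_Icc, ?_⟩
  rintro _ ⟨P, hP, rfl⟩
  have hsub : (Set.pi univ fun t : I => Icc (-(C / δ t)) (C / δ t))ᶜ ⊆
      ⋃ t, {ω : I → ℝ | C / δ t ≤ |ω t|} := by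
    intro ω hω
    simp only [mem_compl_iff, mem_univ_pi, not_forall] at hω
    obtain ⟨t, ht⟩ := hω
    refine mem_iUnion.2 ⟨t, ?_⟩
    simp only [mem_ofPred_eq]
    by_contra h
    exact ht (abs_le.1 (not_le.1 h).le)
  calc (P : Measure (I → ℝ)) _ ≤ (P : Measure (I → ℝ)) (⋃ t, {ω : I → ℝ | C / δ t ≤ |ω t|}) :=
        measure_mono hsub
    _ ≤ ∑' t, (P : Measure (I → ℝ)) {ω : I → ℝ | C / δ t ≤ |ω t|} := measure_iUnion_le _
    _ ≤ ∑' t, (δ t : ℝ≥0∞) := by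
        refine ENNReal.tsum_le_tsum fun t => ?_
        have hd : 0 < (δ t : ℝ) := hδ t
        have h := mul_meas_ge_le_integral_of_nonneg (μ := (P : Measure (I → ℝ)))
          (f := fun ω => |ω t|) (Eventually.of_forall fun _ => abs_nonneg _) (hP t).1.abs (C / δ t)
        have h2 := (hP t).2 0
        simp only [sub_zero] at h2
        have h3 : C / δ t * (P : Measure (I → ℝ)).real {ω : I → ℝ | C / δ t ≤ |ω t|} ≤ C := by
          simp only [C] at *; linarith
        have h4 : (P : Measure (I → ℝ)).real {ω : I → ℝ | C / δ t ≤ |ω t|} ≤ δ t := by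
          rw [div_mul_eq_mul_div, div_le_iff₀ hd] at h3
          exact le_of_mul_le_mul_left h3 hC
        rw [← ENNReal.ofReal_coe_nnreal, ← ofReal_measureReal]
        exact ENNReal.ofReal_le_ofReal h4
    _ ≤ ε := hδs.le

lemma min_cont_closed (t : I) (z c : ℝ) :
    IsClosed {P : ProbabilityMeasure (I → ℝ) |
      Integrable (fun ω : I → ℝ => ω t) (P : Measure (I → ℝ)) ∧
      ∫ ω, |ω t - z| ∂(P : Measure (I → ℝ)) ≤ c} := by
  have key : {P : ProbabilityMeasure (I → ℝ) |
      Integrable (fun ω : I → ℝ => ω t) (P : Measure (I → ℝ)) ∧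
      ∫ ω, |ω t - z| ∂(P : Measure (I → ℝ)) ≤ c} =
      ⋂ N : ℕ, {P : ProbabilityMeasure (I → ℝ) |
        ∫ ω, min |ω t - z| N ∂(P : Measure (I → ℝ)) ≤ c} := by
    ext P
    simp only [mem_ofPred_eq, mem_iInter]
    have hm : ∀ N : ℕ, Measurable fun ω : I → ℝ => min |ω t - z| (N : ℝ) := by
      intro N; fun_prop
    have hnn : ∀ (N : ℕ) (ω : I → ℝ), 0 ≤ min |ω t - z| (N : ℝ) := fun N ω =>
      le_min (abs_nonneg _) (Nat.cast_nonneg _)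
    have hi : ∀ N : ℕ, Integrable (fun ω : I → ℝ => min |ω t - z| (N : ℝ))
        (P : Measure (I → ℝ)) := by
      intro N
      refine Integrable.of_bound (hm N).aestronglyMeasurable (N : ℝ)
        (Eventually.of_forall fun ω => ?_)
      rw [Real.norm_of_nonneg (hnn N ω)]
      exact min_le_right _ _
    constructor
    · rintro ⟨h1, h2⟩ N
      refine le_trans (integral_mono (hi N) (h1.sub (integrable_const z)).abs fun ω => ?_) h2
      exact min_le_left _ _
    · intro h
      have hc : 0 ≤ c := le_trans (integral_nonneg (hnn 0)) (h 0)
      have hl : ∫⁻ ω, ENNReal.ofReal |ω t - z| ∂(P : Measure (I → ℝ)) ≤ ENNReal.ofReal c := by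
        have hsup : ∀ ω : I → ℝ, ENNReal.ofReal |ω t - z| =
            ⨆ N : ℕ, ENNReal.ofReal (min |ω t - z| (N : ℝ)) := by
          intro ω
          apply le_antisymm
          · obtain ⟨N, hN⟩ := exists_nat_ge |ω t - z|
            refine le_trans ?_ (le_iSup _ N)
            rw [min_eq_left hN]
          · exact iSup_le fun N => ENNReal.ofReal_le_ofReal (min_le_left _ _)
        simp_rw [hsup]
        rw [lintegral_iSup]
        · refine iSup_le fun N => ?_
          rw [← ofReal_integral_eq_lintegral_ofReal (hi N) (Eventually.of_forall (hnn N))]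
          exact ENNReal.ofReal_le_ofReal (h N)
        · exact fun N => (hm N).ennreal_ofReal
        · intro M N hMN ω
          exact ENNReal.ofReal_le_ofReal (min_le_min_left _ (by exact_mod_cast hMN))
      have hintg : Integrable (fun ω : I → ℝ => |ω t - z|) (P : Measure (I → ℝ)) := by
        refine ⟨Measurable.aestronglyMeasurable (by fun_prop), ?_⟩
        rw [hasFiniteIntegral_iff_ofReal (Eventually.of_forall fun _ => abs_nonneg _)]
        exact hl.trans_lt ENNReal.ofReal_lt_top
      constructor
      · have h1 : Integrable (fun ω : I → ℝ => ω t - z) (P : Measure (I → ℝ)) :=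
          (integrable_norm_iff (Measurable.aestronglyMeasurable (by fun_prop))).1 hintg
        have h2 := h1.add (integrable_const z)
        have e : ((fun ω : I → ℝ => ω t - z) + fun _ => z) = fun ω => ω t := by
          ext ω; simp
        rwa [e] at h2
      · rw [← ENNReal.ofReal_le_ofReal_iff hc,
          ofReal_integral_eq_lintegral_ofReal hintg (Eventually.of_forall fun _ => abs_nonneg _)]
        exact hl
  rw [key]
  refine isClosed_iInter fun N => ?_
  let f : (I → ℝ) →ᵇ ℝ := BoundedContinuousFunction.ofNormedAddCommGroup
    (fun ω : I → ℝ => min |ω t - z| (N : ℝ)) (by fun_prop) N (fun ω => by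
      rw [Real.norm_of_nonneg (le_min (abs_nonneg _) (Nat.cast_nonneg _))]
      exact min_le_right _ _)
  exact isClosed_le (ProbabilityMeasure.continuous_integral_boundedContinuousFunction f)
    continuous_const

lemma GG_isClosed (ν : Measure ℝ) : IsClosed (GG I ν) := by
  have : GG I ν = ⋂ (t : I) (z : ℝ), {P : ProbabilityMeasure (I → ℝ) |
      Integrable (fun ω : I → ℝ => ω t) (P : Measure (I → ℝ)) ∧
      ∫ ω, |ω t - z| ∂(P : Measure (I → ℝ)) ≤ pot ν z} := by
    ext P
    simp only [GG, mem_ofPred_eq, mem_iInter]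
    exact ⟨fun h t z => ⟨(h t).1, (h t).2 z⟩, fun h t => ⟨(h t 0).1, fun z => (h t z).2⟩⟩
  rw [this]
  exact isClosed_iInter fun t => isClosed_iInter fun z => min_cont_closed t z _

lemma GG_isCompact (ν : Measure ℝ) : IsCompact (GG I ν) := by
  have := isCompact_closure_of_isTightMeasureSet (GG_tight (I := I) ν)
  rwa [(GG_isClosed ν).closure_eq] at this

/-- Truncation. -/
noncomputable def tr (K x : ℝ) : ℝ := max (-K) (min x K)

lemma tr_abs_le {K : ℝ} (hK : 0 ≤ K) (x : ℝ) : |tr K x| ≤ K := by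
  unfold tr
  rw [abs_le]
  exact ⟨le_max_left _ _, max_le (by linarith) (min_le_right _ _)⟩

lemma tr_dist {K : ℝ} (hK : 0 ≤ K) (x : ℝ) :
    |x - tr K x| = (|x - K| + |x - (-K)|) / 2 - K := by
  unfold tr
  rcases le_total x K with h | h <;> rcases le_total (-K) x with h' | h'
  · rw [min_eq_left h, max_eq_right h', abs_of_nonpos (by linarith : x - K ≤ 0),
      abs_of_nonneg (by linarith : 0 ≤ x - (-K))]; simp; ring
  · rw [min_eq_left h, max_eq_left h', abs_of_nonpos (by linarith : x - K ≤ 0),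
      abs_of_nonpos (by linarith : x - (-K) ≤ 0)]; linarith
  · rw [min_eq_right h, max_eq_right (by linarith), abs_of_nonneg (by linarith : 0 ≤ x - K),
      abs_of_nonneg (by linarith : 0 ≤ x - (-K))]; linarith
  · have : x = K := by linarith
    have h0 : K = 0 := by linarith
    subst this; subst h0; simp

lemma tail_integrable {Ω : Type*} {mΩ : MeasurableSpace Ω} {P : Measure Ω}
    [IsProbabilityMeasure P] {X : Ω → ℝ} (hX : Integrable X P) (K : ℝ) :
    Integrable (fun ω => (|X ω - K| + |X ω - (-K)|) / 2 - K) P :=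
  ((((hX.sub (integrable_const K)).abs.add (hX.sub (integrable_const (-K))).abs).div_const
    2).sub (integrable_const K))

lemma tail_integral {Ω : Type*} {mΩ : MeasurableSpace Ω} {P : Measure Ω}
    [IsProbabilityMeasure P] {X : Ω → ℝ} (hX : Integrable X P) (K : ℝ) :
    ∫ ω, (|X ω - K| + |X ω - (-K)|) / 2 - K ∂P =
      (∫ ω, |X ω - K| ∂P + ∫ ω, |X ω - (-K)| ∂P) / 2 - K := by
  have i1 : ∀ z : ℝ, Integrable (fun ω => |X ω - z|) P := fun z =>
    (hX.sub (integrable_const z)).abs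
  have i2 : Integrable (fun ω => |X ω - K| + |X ω - (-K)|) P := (i1 K).add (i1 (-K))
  rw [integral_sub (i2.div_const 2) (integrable_const K), integral_div,
    integral_add (i1 K) (i1 (-K))]
  simp

lemma pot_tail (hν : Integrable (fun x : ℝ => x) ν) :
    Tendsto (fun K : ℕ => (pot ν K + pot ν (-K)) / 2 - K) atTop (𝓝 0) := by
  have h1 : ∀ K : ℕ, (pot ν K + pot ν (-K)) / 2 - K = ∫ x, |x - tr K x| ∂ν := by
    intro K
    simp_rw [tr_dist (Nat.cast_nonneg K)]
    rw [tail_integral hν]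
    rfl
  simp_rw [h1]
  have h0 : (0 : ℝ) = ∫ x : ℝ, (0 : ℝ) ∂ν := by simp
  rw [h0]
  refine tendsto_integral_of_dominated_convergence (fun x => |x|) ?_ hν.abs ?_ ?_
  · intro K
    unfold tr
    fun_prop
  · intro K
    refine Eventually.of_forall fun x => ?_
    have hK : (0 : ℝ) ≤ K := Nat.cast_nonneg K
    rw [Real.norm_eq_abs, abs_abs, tr_dist hK]
    have h1 : |x - K| ≤ |x| + K := by
      have := abs_sub x (K : ℝ); rwa [abs_of_nonneg hK] at this
    have h2 : |x - (-(K : ℝ))| ≤ |x| + K := by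
      have := abs_sub x (-(K : ℝ)); rwa [abs_neg, abs_of_nonneg hK] at this
    linarith
  · refine Eventually.of_forall fun x => ?_
    refine tendsto_const_nhds.congr' ?_
    obtain ⟨N, hN⟩ := exists_nat_ge |x|
    filter_upwards [eventually_ge_atTop N] with K hK
    have hK' : |x| ≤ (K : ℝ) := hN.trans (by exact_mod_cast hK)
    have := abs_le.1 hK'
    unfold tr
    rw [min_eq_left this.2, max_eq_right this.1]
    simp

lemma GG_continuousOn (hν : Integrable (fun x : ℝ => x) ν) (t : I) (f : (I → ℝ) →ᵇ ℝ)
    (h : ℝ → ℝ) (hh : LipschitzWith 1 h) :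
    ContinuousOn (fun P : ProbabilityMeasure (I → ℝ) =>
      ∫ ω, f ω * h (ω t) ∂(P : Measure (I → ℝ))) (GG I ν) := by
  apply continuousOn_of_uniform_approx_of_continuousOn
  intro U hU
  obtain ⟨ε, hε, hεU⟩ := Metric.mem_uniformity_dist.1 hU
  have hlim : Tendsto (fun K : ℕ => ‖f‖ * ((pot ν K + pot ν (-K)) / 2 - K)) atTop (𝓝 0) := by
    simpa using (pot_tail hν).const_mul ‖f‖
  obtain ⟨K, hK⟩ := (hlim.eventually (gt_mem_nhds hε)).exists
  have hK0 : (0 : ℝ) ≤ K := Nat.cast_nonneg K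
  have hLip : ∀ x y, |h x - h y| ≤ |x - y| := fun x y => by
    simpa [Real.dist_eq] using hh.dist_le_mul x y
  have hbd : ∀ x, |h (tr K x)| ≤ |h 0| + K := by
    intro x
    have h1 := hLip (tr K x) 0
    have h2 := tr_abs_le hK0 x
    rw [sub_zero] at h1
    have h3 := abs_sub_abs_le_abs_sub (h (tr K x)) (h 0)
    linarith
  have hhc : Continuous h := hh.continuous
  have htrc : Continuous (tr K) := by unfold tr; fun_prop
  let F : (I → ℝ) →ᵇ ℝ := BoundedContinuousFunction.ofNormedAddCommGroup
    (fun ω : I → ℝ => f ω * h (tr K (ω t))) (by fun_prop) (‖f‖ * (|h 0| + K)) (fun ω => by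
      rw [norm_mul]
      exact mul_le_mul (f.norm_coe_le_norm ω) (hbd _) (norm_nonneg _) (norm_nonneg _))
  refine ⟨fun P => ∫ ω, F ω ∂(P : Measure (I → ℝ)),
    (ProbabilityMeasure.continuous_integral_boundedContinuousFunction F).continuousOn, ?_⟩
  intro P hP
  apply hεU
  obtain ⟨hPi, hPv⟩ := hP t
  have i0 : ∀ z : ℝ, Integrable (fun ω : I → ℝ => |ω t - z|) (P : Measure (I → ℝ)) := fun z =>
    (hPi.sub (integrable_const z)).abs
  have ih : Integrable (fun ω : I → ℝ => h (ω t)) (P : Measure (I → ℝ)) := by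
    refine ((integrable_const |h 0|).add hPi.abs).mono'
      (hhc.measurable.comp (measurable_pi_apply t)).aestronglyMeasurable
      (Eventually.of_forall fun ω => ?_)
    have h1 := hLip (ω t) 0
    rw [sub_zero] at h1
    have h3 := abs_sub_abs_le_abs_sub (h (ω t)) (h 0)
    simp only [Pi.add_apply, Real.norm_eq_abs]
    linarith
  have i1 : Integrable (fun ω : I → ℝ => f ω * h (ω t)) (P : Measure (I → ℝ)) :=
    ih.bdd_mul (c := ‖f‖) (by fun_prop) (Eventually.of_forall fun ω => f.norm_coe_le_norm ω)
  have i2 : Integrable (fun ω : I → ℝ => F ω) (P : Measure (I → ℝ)) := F.integrable _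
  rw [Real.dist_eq, ← integral_sub i1 i2]
  refine lt_of_le_of_lt ?_ hK
  calc |∫ ω, f ω * h (ω t) - F ω ∂(P : Measure (I → ℝ))|
      ≤ ∫ ω, |f ω * h (ω t) - F ω| ∂(P : Measure (I → ℝ)) := abs_integral_le_integral_abs
    _ ≤ ∫ ω, ‖f‖ * ((|ω t - K| + |ω t - (-K)|) / 2 - K) ∂(P : Measure (I → ℝ)) := by
        refine integral_mono (i1.sub i2).abs
          ((tail_integrable hPi _).const_mul _) fun ω => ?_
        show |f ω * h (ω t) - f ω * h (tr K (ω t))| ≤ _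
        rw [← mul_sub, abs_mul, ← tr_dist hK0]
        exact mul_le_mul (f.norm_coe_le_norm ω) (hLip _ _) (abs_nonneg _) (norm_nonneg _)
    _ = ‖f‖ * ((∫ ω, |ω t - K| ∂(P : Measure (I → ℝ)) +
          ∫ ω, |ω t - (-K)| ∂(P : Measure (I → ℝ))) / 2 - K) := by
        rw [integral_const_mul, tail_integral hPi]
    _ ≤ _ := by
        have a1 := hPv K
        have a2 := hPv (-K)
        gcongr

lemma GG_continuousOn_pot (hν : Integrable (fun x : ℝ => x) ν) (t : I) (z : ℝ) :
    ContinuousOn (fun P : ProbabilityMeasure (I → ℝ) =>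
      ∫ ω, |ω t - z| ∂(P : Measure (I → ℝ))) (GG I ν) := by
  have := GG_continuousOn hν t (BoundedContinuousFunction.const _ 1) (fun x => |x - z|)
    (LipschitzWith.of_dist_le_mul fun x y => by
      simp only [Real.dist_eq, NNReal.coe_one, one_mul]
      have := abs_abs_sub_abs_le_abs_sub (x - z) (y - z)
      simpa using this)
  simpa using this

lemma GG_continuousOn_mean (hν : Integrable (fun x : ℝ => x) ν) (t : I) :
    ContinuousOn (fun P : ProbabilityMeasure (I → ℝ) =>
      ∫ ω, ω t ∂(P : Measure (I → ℝ))) (GG I ν) := by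
  have := GG_continuousOn hν t (BoundedContinuousFunction.const _ 1) (fun x => x)
    LipschitzWith.id
  simpa using this

end compactness

section martingale

variable {I : Type*} [Countable I] [LinearOrder I]

/-- Restriction of a path to the times before `s`. -/
def rst (s : I) (ω : I → ℝ) : Iic s → ℝ := fun i => ω i

lemma rst_continuous (s : I) : Continuous (rst s) := by unfold rst; fun_prop

/-- Martingale property tested against bounded continuous functions. -/
def MC (P : Measure (I → ℝ)) : Prop :=
  ∀ s t : I, s ≤ t → ∀ f : (Iic s → ℝ) →ᵇ ℝ, ∫ ω, f (rst s ω) * (ω t - ω s) ∂P = 0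

lemma natFiltration_eq (s : I) :
    (natFiltration I) s = MeasurableSpace.comap (rst s) MeasurableSpace.pi := by
  show (⨆ t ∈ Set.Iic s, MeasurableSpace.comap (fun ω : I → ℝ => ω t) inferInstance) = _
  rw [MeasurableSpace.pi, MeasurableSpace.comap_iSup]
  simp_rw [MeasurableSpace.comap_comp]
  rw [iSup_subtype']
  rfl

lemma rst_measurable (s : I) : Measurable[natFiltration I s] (rst s) := by
  rw [natFiltration_eq]
  exact comap_measurable _

lemma coord_measurable (s : I) : Measurable[natFiltration I s] (fun ω : I → ℝ => ω s) := by
  have : (fun ω : I → ℝ => ω s) = (fun x : Iic s → ℝ => x ⟨s, le_refl s⟩) ∘ rst s := rfl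
  rw [this]
  exact (measurable_pi_apply _).comp (rst_measurable s)

lemma bcf_mul_integrable {P : Measure (I → ℝ)} (s : I) (f : (Iic s → ℝ) →ᵇ ℝ)
    {X : (I → ℝ) → ℝ} (hX : Integrable X P) : Integrable (fun ω => f (rst s ω) * X ω) P :=
  hX.bdd_mul (c := ‖f‖) (f.continuous.comp (rst_continuous s)).measurable.aestronglyMeasurable
    (Eventually.of_forall fun ω => f.norm_coe_le_norm _)

lemma MC_of_martingale {P : Measure (I → ℝ)} [IsProbabilityMeasure P]
    (h : Martingale (fun (t : I) (ω : I → ℝ) => ω t) (natFiltration I) P) : MC P := by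
  intro s t hst f
  have hle := (natFiltration I).le s
  have hfm : StronglyMeasurable[natFiltration I s] (fun ω => f (rst s ω)) :=
    (f.continuous.measurable.comp (rst_measurable s)).stronglyMeasurable
  have h1 := condExp_mul_of_stronglyMeasurable_left (μ := P) hfm
    (bcf_mul_integrable s f (h.integrable t)) (h.integrable t)
  have h2 : ∫ ω, f (rst s ω) * ω t ∂P = ∫ ω, f (rst s ω) * ω s ∂P := by
    rw [← integral_condExp hle]
    apply integral_congr_ae
    filter_upwards [h1, h.condExp_ae_eq hst] with ω h1 h2
    have h1' := h1
    simp only [Pi.mul_apply] at h1'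
    rw [h2] at h1'
    exact h1'
  simp_rw [mul_sub]
  rw [integral_sub (bcf_mul_integrable s f (h.integrable t))
    (bcf_mul_integrable s f (h.integrable s)), h2, sub_self]

lemma martingale_of_MC {P : Measure (I → ℝ)} [IsProbabilityMeasure P]
    (hi : ∀ t : I, Integrable (fun ω : I → ℝ => ω t) P) (h : MC P) :
    Martingale (fun (t : I) (ω : I → ℝ) => ω t) (natFiltration I) P := by
  refine ⟨fun s => (coord_measurable s).stronglyMeasurable, ?_⟩
  intro s t hst
  have hle := (natFiltration I).le s
  have hrm : Measurable (rst s) := (rst_continuous s).measurable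
  refine (ae_eq_condExp_of_forall_setIntegral_eq hle (hi t)
    (fun A _ _ => (hi s).integrableOn) ?_
    (coord_measurable s).stronglyMeasurable.aestronglyMeasurable).symm
  have hX : Integrable (fun ω : I → ℝ => ω t - ω s) P := (hi t).sub (hi s)
  let wp : (I → ℝ) → ℝ≥0 := fun ω => (ω t - ω s).toNNReal
  let wn : (I → ℝ) → ℝ≥0 := fun ω => (-(ω t - ω s)).toNNReal
  have mwp : Measurable wp := by fun_prop
  have mwn : Measurable wn := by fun_prop
  have hsplit : ∀ ω, (wp ω : ℝ) - wn ω = ω t - ω s := by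
    intro ω
    simp only [wp, wn, Real.coe_toNNReal']
    rcases le_total 0 (ω t - ω s) with h | h
    · rw [max_eq_left h, max_eq_right (by linarith)]; ring
    · rw [max_eq_right h, max_eq_left (by linarith)]; ring
  have iwp : Integrable (fun ω => (wp ω : ℝ)) P := hX.real_toNNReal
  have iwn : Integrable (fun ω => (wn ω : ℝ)) P := hX.neg.real_toNNReal
  have fin : ∀ w : (I → ℝ) → ℝ≥0, Integrable (fun ω => (w ω : ℝ)) P →
      IsFiniteMeasure (P.withDensity fun ω => (w ω : ℝ≥0∞)) := by
    intro w iw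
    refine isFiniteMeasure_withDensity ?_
    have := iw.lintegral_lt_top
    simp only [ENNReal.ofReal_coe_nnreal] at this
    exact this.ne
  have := fin wp iwp
  have := fin wn iwn
  have heq : (P.withDensity fun ω => (wp ω : ℝ≥0∞)).map (rst s) =
      (P.withDensity fun ω => (wn ω : ℝ≥0∞)).map (rst s) := by
    apply ext_of_forall_integral_eq_of_IsFiniteMeasure
    intro f
    rw [integral_map hrm.aemeasurable f.continuous.measurable.aestronglyMeasurable,
      integral_map hrm.aemeasurable f.continuous.measurable.aestronglyMeasurable,
      integral_withDensity_eq_integral_smul mwp, integral_withDensity_eq_integral_smul mwn,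
      ← sub_eq_zero]
    simp only [NNReal.smul_def, smul_eq_mul]
    rw [← integral_sub]
    · rw [← h s t hst f]
      congr 1
      ext ω
      rw [← hsplit]; ring
    · simpa [mul_comm] using bcf_mul_integrable s f iwp
    · simpa [mul_comm] using bcf_mul_integrable s f iwn
  intro A hA _
  rw [natFiltration_eq] at hA
  obtain ⟨B, hB, rfl⟩ := hA
  have hAm : MeasurableSet (rst s ⁻¹' B) := hrm hB
  have hval : ∀ w : (I → ℝ) → ℝ≥0, Measurable w → Integrable (fun ω => (w ω : ℝ)) P →
      ENNReal.ofReal (∫ ω in rst s ⁻¹' B, (w ω : ℝ) ∂P) =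
        (P.withDensity fun ω => (w ω : ℝ≥0∞)).map (rst s) B := by
    intro w mw iw
    rw [Measure.map_apply hrm hB, withDensity_apply _ hAm,
      ofReal_integral_eq_lintegral_ofReal iw.integrableOn
        (Eventually.of_forall fun ω => NNReal.coe_nonneg _)]
    simp
  have hfin : ∫ ω in rst s ⁻¹' B, (wp ω : ℝ) ∂P = ∫ ω in rst s ⁻¹' B, (wn ω : ℝ) ∂P := by
    have h1 := hval wp mwp iwp
    rw [heq, ← hval wn mwn iwn] at h1
    exact (ENNReal.ofReal_eq_ofReal_iff
      (integral_nonneg fun ω => NNReal.coe_nonneg _)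
      (integral_nonneg fun ω => NNReal.coe_nonneg _)).1 h1
  have h0 : ∫ ω in rst s ⁻¹' B, (ω t - ω s) ∂P = 0 := by
    simp_rw [← hsplit]
    rw [integral_sub iwp.integrableOn iwn.integrableOn, hfin, sub_self]
  rw [integral_sub (hi t).integrableOn (hi s).integrableOn] at h0
  linarith

/-- Martingale measures with potentials bounded by that of `ν`. -/
def MM (I : Type*) [LinearOrder I] (ν : Measure ℝ) : Set (ProbabilityMeasure (I → ℝ)) :=
  {P | P ∈ GG I ν ∧ MC (P : Measure (I → ℝ))}

lemma MM_isClosed {ν : Measure ℝ} [IsProbabilityMeasure ν] (hν : Integrable (fun x : ℝ => x) ν) :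
    IsClosed (MM I ν) := by
  have : MM I ν = GG I ν ∩ ⋂ (s : I) (t : I) (_ : s ≤ t) (f : (Iic s → ℝ) →ᵇ ℝ),
      (GG I ν ∩ (fun P : ProbabilityMeasure (I → ℝ) =>
        (∫ ω, f (rst s ω) * ω t ∂(P : Measure (I → ℝ))) -
          ∫ ω, f (rst s ω) * ω s ∂(P : Measure (I → ℝ))) ⁻¹' {0}) := by
    ext P
    simp only [MM, MC, mem_ofPred_eq, mem_inter_iff, mem_iInter, mem_preimage, mem_singleton_iff]
    refine and_congr_right fun hP => forall₄_congr fun s t hst f => ?_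
    simp_rw [mul_sub]
    rw [integral_sub (bcf_mul_integrable s f (hP t).1) (bcf_mul_integrable s f (hP s).1)]
    simp [hP]
  rw [this]
  refine (GG_isClosed ν).inter (isClosed_iInter fun s => isClosed_iInter fun t =>
    isClosed_iInter fun hst => isClosed_iInter fun f => ?_)
  refine ContinuousOn.preimage_isClosed_of_isClosed ?_ (GG_isClosed ν) isClosed_singleton
  let F : (I → ℝ) →ᵇ ℝ := f.compContinuous ⟨rst s, rst_continuous s⟩
  exact (GG_continuousOn hν t F (fun x => x) LipschitzWith.id).sub
    (GG_continuousOn hν s F (fun x => x) LipschitzWith.id)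

lemma MM_isCompact {ν : Measure ℝ} [IsProbabilityMeasure ν]
    (hν : Integrable (fun x : ℝ => x) ν) : IsCompact (MM I ν) :=
  (GG_isCompact ν).of_isClosed_subset (MM_isClosed hν) fun _ h => h.1

lemma marg_isClosed (t : I) (μ : ProbabilityMeasure ℝ) :
    IsClosed {P : ProbabilityMeasure (I → ℝ) |
      (P : Measure (I → ℝ)).map (fun ω => ω t) = (μ : Measure ℝ)} := by
  have : {P : ProbabilityMeasure (I → ℝ) |
      (P : Measure (I → ℝ)).map (fun ω => ω t) = (μ : Measure ℝ)} =
      (fun P : ProbabilityMeasure (I → ℝ) => P.map (f := fun ω : I → ℝ => ω t)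
        (continuous_apply t).measurable.aemeasurable) ⁻¹' {μ} := by
    ext P
    simp only [mem_ofPred_eq, mem_preimage, mem_singleton_iff]
    rw [← ProbabilityMeasure.toMeasure_injective.eq_iff]
    rfl
  rw [this]
  exact isClosed_singleton.preimage (ProbabilityMeasure.continuous_map (continuous_apply t))

end martingale

section sweeping

/-- Weight of the left end point. -/
noncomputable def wa (a b x : ℝ) : ℝ := if a ≤ x ∧ x ≤ b then (b - x) / (b - a) else 0
/-- Weight of the right end point. -/
noncomputable def wb (a b x : ℝ) : ℝ := if a ≤ x ∧ x ≤ b then (x - a) / (b - a) else 0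
/-- Weight of staying put. -/
noncomputable def w0 (a b x : ℝ) : ℝ := if a ≤ x ∧ x ≤ b then 0 else 1

variable {a b : ℝ}

lemma wa_nonneg (hab : a < b) (x : ℝ) : 0 ≤ wa a b x := by
  unfold wa; split_ifs with h
  · exact div_nonneg (by linarith) (by linarith)
  · exact le_rfl

lemma wb_nonneg (hab : a < b) (x : ℝ) : 0 ≤ wb a b x := by
  unfold wb; split_ifs with h
  · exact div_nonneg (by linarith) (by linarith)
  · exact le_rfl

lemma w0_nonneg (x : ℝ) : 0 ≤ w0 a b x := by
  unfold w0; split_ifs <;> norm_num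

lemma w_sum (hab : a < b) (x : ℝ) : w0 a b x + wa a b x + wb a b x = 1 := by
  have : b - a ≠ 0 := by linarith
  unfold w0 wa wb; split_ifs with h
  · field_simp; ring
  · norm_num

lemma w_mean (hab : a < b) (x : ℝ) : w0 a b x * x + wa a b x * a + wb a b x * b = x := by
  have : b - a ≠ 0 := by linarith
  unfold w0 wa wb; split_ifs with h
  · field_simp; ring
  · norm_num

lemma w_abs_ge (hab : a < b) (x z : ℝ) :
    |x - z| ≤ w0 a b x * |x - z| + wa a b x * |a - z| + wb a b x * |b - z| := by
  have h0 := w0_nonneg (a := a) (b := b) x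
  have h1 := wa_nonneg hab x
  have h2 := wb_nonneg hab x
  have e : x - z = w0 a b x * (x - z) + wa a b x * (a - z) + wb a b x * (b - z) := by
    have := w_mean hab x
    have := w_sum hab x
    linear_combination z * (w_sum hab x) - w_mean hab x
  calc |x - z| = |w0 a b x * (x - z) + wa a b x * (a - z) + wb a b x * (b - z)| := by rw [← e]
    _ ≤ |w0 a b x * (x - z)| + |wa a b x * (a - z)| + |wb a b x * (b - z)| := abs_add_three _ _ _
    _ = _ := by rw [abs_mul, abs_mul, abs_mul, abs_of_nonneg h0, abs_of_nonneg h1,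
                  abs_of_nonneg h2]

lemma w_abs_out (hab : a < b) (x z : ℝ) (hz : z ≤ a ∨ b ≤ z) :
    w0 a b x * |x - z| + wa a b x * |a - z| + wb a b x * |b - z| = |x - z| := by
  have : b - a ≠ 0 := by linarith
  unfold w0 wa wb; split_ifs with h
  · rcases hz with hz | hz
    · rw [abs_of_nonneg (by linarith : 0 ≤ x - z), abs_of_nonneg (by linarith : 0 ≤ a - z),
        abs_of_nonneg (by linarith : 0 ≤ b - z)]
      field_simp; ring
    · rw [abs_of_nonpos (by linarith : x - z ≤ 0), abs_of_nonpos (by linarith : a - z ≤ 0),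
        abs_of_nonpos (by linarith : b - z ≤ 0)]
      field_simp; ring
  · norm_num

lemma w_abs_in (hab : a < b) (x z : ℝ) (hza : a ≤ z) (hzb : z ≤ b) :
    w0 a b x * |x - z| + wa a b x * |a - z| + wb a b x * |b - z| =
      ((b - z) * |x - a| + (z - a) * |x - b|) / (b - a) := by
  have : b - a ≠ 0 := by linarith
  unfold w0 wa wb; split_ifs with h
  · rw [abs_of_nonpos (by linarith : a - z ≤ 0), abs_of_nonneg (by linarith : 0 ≤ b - z),
      abs_of_nonneg (by linarith : 0 ≤ x - a), abs_of_nonpos (by linarith : x - b ≤ 0)]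
    field_simp; ring
  · rcases lt_or_ge x a with hx | hx
    · rw [abs_of_nonpos (by linarith : x - z ≤ 0), abs_of_nonpos (by linarith : x - a ≤ 0),
        abs_of_nonpos (by linarith : x - b ≤ 0)]
      field_simp; ring
    · have hx' : b < x := by
        by_contra h'
        exact h ⟨hx, not_lt.1 h'⟩
      rw [abs_of_nonneg (by linarith : 0 ≤ x - z), abs_of_nonneg (by linarith : 0 ≤ x - a),
        abs_of_nonneg (by linarith : 0 ≤ x - b)]
      field_simp; ring

lemma measurable_wa : Measurable (wa a b) := by
  unfold wa
  exact Measurable.ite measurableSet_Icc (by fun_prop) (by fun_prop)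

lemma measurable_wb : Measurable (wb a b) := by
  unfold wb
  exact Measurable.ite measurableSet_Icc (by fun_prop) (by fun_prop)

lemma measurable_w0 : Measurable (w0 a b) := by
  unfold w0
  exact Measurable.ite measurableSet_Icc (by fun_prop) (by fun_prop)

variable {I : Type*} [Countable I] [LinearOrder I]

/-- Freeze the path to the value `y` from time `c` on. -/
def sw (c : I) (ω : I → ℝ) (y : ℝ) : I → ℝ := fun t => if t < c then ω t else y

lemma measurable_sw (c : I) (Y : (I → ℝ) → ℝ) (hY : Measurable Y) :
    Measurable (fun ω => sw c ω (Y ω)) := by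
  refine measurable_pi_lambda _ fun t => ?_
  unfold sw
  split_ifs
  · exact measurable_pi_apply t
  · exact hY

/-- One piece of the swept measure. -/
noncomputable def piece (P : Measure (I → ℝ)) (c : I) (w : ℝ → ℝ) (Y : (I → ℝ) → ℝ) :
    Measure (I → ℝ) :=
  (P.withDensity fun ω => ((w (ω c)).toNNReal : ℝ≥0∞)).map (fun ω => sw c ω (Y ω))

lemma piece_integral {P : Measure (I → ℝ)} {c : I} {w : ℝ → ℝ}
    (hw : Measurable w) (hw0 : ∀ x, 0 ≤ w x) (hw1 : ∀ x, w x ≤ 1)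
    {Y : (I → ℝ) → ℝ} (hY : Measurable Y) {g : (I → ℝ) → ℝ} (hg : Measurable g)
    (hi : Integrable (fun ω => g (sw c ω (Y ω))) P) :
    Integrable g (piece P c w Y) ∧ Integrable (fun ω => w (ω c) * g (sw c ω (Y ω))) P ∧
      ∫ ω, g ω ∂(piece P c w Y) = ∫ ω, w (ω c) * g (sw c ω (Y ω)) ∂P := by
  have hwm : Measurable fun ω : I → ℝ => (w (ω c)).toNNReal := by fun_prop
  have hi2 : Integrable (fun ω => w (ω c) * g (sw c ω (Y ω))) P :=
    hi.bdd_mul (c := 1) (hw.comp (measurable_pi_apply c)).aestronglyMeasurable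
      (Eventually.of_forall fun ω => by
        rw [Real.norm_of_nonneg (hw0 _)]; exact hw1 _)
  have e : (fun ω : I → ℝ => (w (ω c)).toNNReal • g (sw c ω (Y ω))) =
      fun ω => w (ω c) * g (sw c ω (Y ω)) := by
    ext ω
    rw [NNReal.smul_def, Real.coe_toNNReal _ (hw0 _), smul_eq_mul]
  refine ⟨?_, hi2, ?_⟩
  · unfold piece
    rw [integrable_map_measure hg.aestronglyMeasurable (measurable_sw c Y hY).aemeasurable]
    rw [integrable_withDensity_iff_integrable_smul hwm]
    simpa only [Function.comp_apply, e] using hi2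
  · unfold piece
    rw [integral_map (measurable_sw c Y hY).aemeasurable hg.aestronglyMeasurable,
      integral_withDensity_eq_integral_smul hwm, e]

lemma piece_univ {P : Measure (I → ℝ)} {c : I} {w : ℝ → ℝ}
    {Y : (I → ℝ) → ℝ} (hY : Measurable Y) :
    piece P c w Y univ = ∫⁻ ω, ENNReal.ofReal (w (ω c)) ∂P := by
  unfold piece
  rw [Measure.map_apply (measurable_sw c Y hY) MeasurableSet.univ, preimage_univ,
    withDensity_apply _ MeasurableSet.univ, Measure.restrict_univ]
  rfl

/-- The swept measure. -/
noncomputable def swept (P : Measure (I → ℝ)) (c : I) (a b : ℝ) : Measure (I → ℝ) :=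
  piece P c (w0 a b) (fun ω => ω c) + piece P c (wa a b) (fun _ => a) +
    piece P c (wb a b) (fun _ => b)

lemma swept_prob (hab : a < b) (P : Measure (I → ℝ)) [IsProbabilityMeasure P] (c : I) :
    IsProbabilityMeasure (swept P c a b) := by
  constructor
  have m0 : Measurable fun ω : I → ℝ => ENNReal.ofReal (w0 a b (ω c)) :=
    (measurable_w0.comp (measurable_pi_apply c)).ennreal_ofReal
  have ma : Measurable fun ω : I → ℝ => ENNReal.ofReal (wa a b (ω c)) :=
    (measurable_wa.comp (measurable_pi_apply c)).ennreal_ofReal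
  have m0a : Measurable fun ω : I → ℝ => ENNReal.ofReal (w0 a b (ω c)) +
      ENNReal.ofReal (wa a b (ω c)) := m0.add ma
  unfold swept
  rw [Measure.add_apply, Measure.add_apply, piece_univ (measurable_pi_apply c),
    piece_univ measurable_const, piece_univ measurable_const, ← lintegral_add_left m0,
    ← lintegral_add_left m0a]
  have : ∀ ω : I → ℝ, ENNReal.ofReal (w0 a b (ω c)) + ENNReal.ofReal (wa a b (ω c)) +
      ENNReal.ofReal (wb a b (ω c)) = 1 := by
    intro ω
    rw [← ENNReal.ofReal_add (w0_nonneg _) (wa_nonneg hab _),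
      ← ENNReal.ofReal_add (add_nonneg (w0_nonneg _) (wa_nonneg hab _)) (wb_nonneg hab _),
      w_sum hab, ENNReal.ofReal_one]
  simp_rw [this]
  simp

lemma swept_integral (hab : a < b) {P : Measure (I → ℝ)} {c : I}
    {g : (I → ℝ) → ℝ} (hg : Measurable g)
    (h0 : Integrable (fun ω => g (sw c ω (ω c))) P)
    (ha : Integrable (fun ω => g (sw c ω a)) P)
    (hb : Integrable (fun ω => g (sw c ω b)) P) :
    Integrable g (swept P c a b) ∧
      ∫ ω, g ω ∂(swept P c a b) = ∫ ω, (w0 a b (ω c) * g (sw c ω (ω c)) +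
        wa a b (ω c) * g (sw c ω a) + wb a b (ω c) * g (sw c ω b)) ∂P := by
  have n0 := w0_nonneg (a := a) (b := b)
  have na := wa_nonneg hab
  have nb := wb_nonneg hab
  have s := w_sum hab
  obtain ⟨i0, j0, e0⟩ := piece_integral (P := P) (c := c) measurable_w0 n0
    (fun x => by linarith [n0 x, na x, nb x, s x]) (measurable_pi_apply c) hg h0
  obtain ⟨ia, ja, ea⟩ := piece_integral (P := P) (c := c) measurable_wa na
    (fun x => by linarith [n0 x, na x, nb x, s x]) (Y := fun _ => a) measurable_const hg ha
  obtain ⟨ib, jb, eb⟩ := piece_integral (P := P) (c := c) measurable_wb nb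
    (fun x => by linarith [n0 x, na x, nb x, s x]) (Y := fun _ => b) measurable_const hg hb
  refine ⟨(i0.add_measure ia).add_measure ib, ?_⟩
  unfold swept
  have j0a : Integrable (fun ω => w0 a b (ω c) * g (sw c ω (ω c)) +
        wa a b (ω c) * g (sw c ω a)) P := j0.add ja
  rw [integral_add_measure (i0.add_measure ia) ib, integral_add_measure i0 ia, e0, ea, eb,
    integral_add j0a jb, integral_add j0 ja]

lemma sw_lt {c t : I} (h : t < c) (ω : I → ℝ) (y : ℝ) : sw c ω y t = ω t := by simp [sw, h]
lemma sw_ge {c t : I} (h : ¬ t < c) (ω : I → ℝ) (y : ℝ) : sw c ω y t = y := by simp [sw, h]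

lemma rst_sw {c s : I} (h : s < c) (ω : I → ℝ) (y : ℝ) : rst s (sw c ω y) = rst s ω := by
  ext i
  exact sw_lt (lt_of_le_of_lt i.2 h) ω y

/-- Functionals of the path before `c` are unaffected. -/
lemma swept_integral_before (hab : a < b) {P : Measure (I → ℝ)} {c : I}
    {g : (I → ℝ) → ℝ} (hg : Measurable g) (hi : Integrable g P)
    (hgc : ∀ ω y, g (sw c ω y) = g ω) :
    Integrable g (swept P c a b) ∧ ∫ ω, g ω ∂(swept P c a b) = ∫ ω, g ω ∂P := by
  have h0 : ∀ Y : (I → ℝ) → ℝ, Integrable (fun ω => g (sw c ω (Y ω))) P := by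
    intro Y; simpa only [hgc] using hi
  obtain ⟨h1, h2⟩ := swept_integral hab hg (h0 fun ω => ω c) (h0 fun _ => a) (h0 fun _ => b)
  refine ⟨h1, h2.trans ?_⟩
  congr 1; ext ω
  rw [hgc, hgc, hgc, ← add_mul, ← add_mul, w_sum hab, one_mul]

lemma swept_abs (hab : a < b) {P : Measure (I → ℝ)} [IsProbabilityMeasure P] {c t : I}
    (hct : ¬ t < c) (hi : ∀ t : I, Integrable (fun ω : I → ℝ => ω t) P) (z : ℝ) :
    ∫ ω, |ω t - z| ∂(swept P c a b) = ∫ ω, (w0 a b (ω c) * |ω c - z| +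
        wa a b (ω c) * |a - z| + wb a b (ω c) * |b - z|) ∂P := by
  have hic : Integrable (fun ω : I → ℝ => |ω c - z|) P :=
    ((hi c).sub (integrable_const z)).abs
  have := (swept_integral (P := P) (c := c) hab (g := fun ω => |ω t - z|) (by fun_prop)
    (by simpa only [sw_ge hct] using hic)
    (by simp only [sw_ge hct]; exact integrable_const _)
    (by simp only [sw_ge hct]; exact integrable_const _)).2
  simpa only [sw_ge hct] using this

lemma swept_coord (hab : a < b) {P : Measure (I → ℝ)} [IsProbabilityMeasure P] {c : I}
    (hi : ∀ t : I, Integrable (fun ω : I → ℝ => ω t) P) (t : I) :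
    Integrable (fun ω : I → ℝ => ω t) (swept P c a b) ∧
      ((¬ t < c) → ∫ ω, ω t ∂(swept P c a b) = ∫ ω, ω c ∂P) := by
  by_cases htc : t < c
  · exact ⟨(swept_integral_before (P := P) (c := c) hab (measurable_pi_apply t) (hi t)
      (fun ω y => sw_lt htc ω y)).1, fun h => absurd htc h⟩
  · have := swept_integral (P := P) (c := c) hab (g := fun ω => ω t) (measurable_pi_apply t)
      (by simpa only [sw_ge htc] using hi c)
      (by simp only [sw_ge htc]; exact integrable_const _)
      (by simp only [sw_ge htc]; exact integrable_const _)
    refine ⟨this.1, fun _ => this.2.trans ?_⟩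
    simp only [sw_ge htc, w_mean hab]

lemma swept_MC (hab : a < b) {P : Measure (I → ℝ)} [IsProbabilityMeasure P] {c : I}
    (hi : ∀ t : I, Integrable (fun ω : I → ℝ => ω t) P) (hP : MC P) : MC (swept P c a b) := by
  intro s t hst f
  have hfm : Measurable fun ω : I → ℝ => f (rst s ω) :=
    (f.continuous.comp (rst_continuous s)).measurable
  have hgm : Measurable fun ω : I → ℝ => f (rst s ω) * (ω t - ω s) :=
    hfm.mul ((measurable_pi_apply t).sub (measurable_pi_apply s))
  by_cases htc : t < c
  · have hsc : s < c := lt_of_le_of_lt hst htc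
    rw [(swept_integral_before (P := P) (c := c) hab hgm
      (bcf_mul_integrable s f ((hi t).sub (hi s)))
      (fun ω y => by rw [rst_sw hsc, sw_lt htc, sw_lt hsc])).2]
    exact hP s t hst f
  by_cases hsc : s < c
  · have h0 : Integrable (fun ω : I → ℝ => f (rst s ω) * (ω c - ω s)) P :=
      bcf_mul_integrable s f ((hi c).sub (hi s))
    have h1 : ∀ y : ℝ, Integrable (fun ω : I → ℝ => f (rst s ω) * (y - ω s)) P := fun y =>
      bcf_mul_integrable s f ((integrable_const y).sub (hi s))
    have := (swept_integral (P := P) (c := c) hab hgm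
      (by simpa only [rst_sw hsc, sw_lt hsc, sw_ge htc] using h0)
      (by simpa only [rst_sw hsc, sw_lt hsc, sw_ge htc] using h1 a)
      (by simpa only [rst_sw hsc, sw_lt hsc, sw_ge htc] using h1 b)).2
    rw [this, ← hP s c hsc.le f]
    congr 1; ext ω
    simp only [rst_sw hsc, sw_lt hsc, sw_ge htc]
    linear_combination f (rst s ω) * (w_mean hab (ω c)) - f (rst s ω) * ω s * (w_sum hab (ω c))
  · have e : ∀ ω y, f (rst s (sw c ω y)) * (sw c ω y t - sw c ω y s) = 0 := by
      intro ω y; rw [sw_ge htc, sw_ge hsc, sub_self, mul_zero]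
    have := (swept_integral (P := P) (c := c) hab hgm
      (by simp only [e]; exact integrable_const _) (by simp only [e]; exact integrable_const _)
      (by simp only [e]; exact integrable_const _)).2
    rw [this]
    simp [e]

lemma sweep (hab : a < b) {ν : Measure ℝ} {P : ProbabilityMeasure (I → ℝ)} (hP : P ∈ MM I ν)
    (c : I)
    (hu : ∀ z, a ≤ z → z ≤ b → ((b - z) * (∫ ω, |ω c - a| ∂(P : Measure (I → ℝ))) +
      (z - a) * (∫ ω, |ω c - b| ∂(P : Measure (I → ℝ)))) / (b - a) ≤ pot ν z) :
    ∃ P' ∈ MM I ν,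
      (∀ t < c, (P' : Measure (I → ℝ)).map (fun ω => ω t) =
        (P : Measure (I → ℝ)).map (fun ω => ω t)) ∧
      (∫ ω, ω c ∂(P' : Measure (I → ℝ)) = ∫ ω, ω c ∂(P : Measure (I → ℝ))) ∧
      (∀ z, ∫ ω, |ω c - z| ∂(P : Measure (I → ℝ)) ≤ ∫ ω, |ω c - z| ∂(P' : Measure (I → ℝ))) ∧
      (∀ z, a ≤ z → z ≤ b → ∫ ω, |ω c - z| ∂(P' : Measure (I → ℝ)) =
        ((b - z) * (∫ ω, |ω c - a| ∂(P : Measure (I → ℝ))) +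
          (z - a) * (∫ ω, |ω c - b| ∂(P : Measure (I → ℝ)))) / (b - a)) := by
  have hi : ∀ t : I, Integrable (fun ω : I → ℝ => ω t) (P : Measure (I → ℝ)) :=
    fun t => (hP.1 t).1
  have hia : ∀ (t : I) (z : ℝ), Integrable (fun ω : I → ℝ => |ω t - z|) (P : Measure (I → ℝ)) :=
    fun t z => ((hi t).sub (integrable_const z)).abs
  have hprob := swept_prob (a := a) (b := b) hab (P : Measure (I → ℝ)) c
  have hin : ∀ (t : I), ¬ t < c → ∀ z, a ≤ z → z ≤ b →
      ∫ ω, |ω t - z| ∂(swept (P : Measure (I → ℝ)) c a b) =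
        ((b - z) * (∫ ω, |ω c - a| ∂(P : Measure (I → ℝ))) +
          (z - a) * (∫ ω, |ω c - b| ∂(P : Measure (I → ℝ)))) / (b - a) := by
    intro t ht z hz1 hz2
    rw [swept_abs hab ht hi z]
    simp_rw [w_abs_in hab _ z hz1 hz2]
    rw [integral_div, integral_add ((hia c a).const_mul _) ((hia c b).const_mul _),
      integral_const_mul, integral_const_mul]
  have hout : ∀ (t : I), ¬ t < c → ∀ z, (z ≤ a ∨ b ≤ z) →
      ∫ ω, |ω t - z| ∂(swept (P : Measure (I → ℝ)) c a b) =
        ∫ ω, |ω c - z| ∂(P : Measure (I → ℝ)) := by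
    intro t ht z hz
    rw [swept_abs hab ht hi z]
    simp_rw [w_abs_out hab _ z hz]
  refine ⟨⟨swept (P : Measure (I → ℝ)) c a b, hprob⟩, ⟨?_, swept_MC hab hi hP.2⟩, ?_, ?_, ?_, ?_⟩
  · intro t
    refine ⟨(swept_coord hab hi t).1, fun z => ?_⟩
    simp only [ProbabilityMeasure.coe_mk]
    by_cases ht : t < c
    · rw [(swept_integral_before (P := (P : Measure (I → ℝ))) (c := c) hab
        (g := fun ω => |ω t - z|) (by fun_prop) (hia t z)
        (fun ω y => by rw [sw_lt ht])).2]
      exact (hP.1 t).2 z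
    · by_cases hz : z ≤ a ∨ b ≤ z
      · rw [hout t ht z hz]; exact (hP.1 c).2 z
      · push Not at hz
        rw [hin t ht z hz.1.le hz.2.le]
        exact hu z hz.1.le hz.2.le
  · intro t ht
    simp only [ProbabilityMeasure.coe_mk]
    have m1 : Measurable fun ω : I → ℝ => ω t := measurable_pi_apply t
    have := Measure.isProbabilityMeasure_map (μ := (P : Measure (I → ℝ))) m1.aemeasurable
    have := Measure.isProbabilityMeasure_map (μ := swept (P : Measure (I → ℝ)) c a b)
      m1.aemeasurable
    apply ext_of_forall_integral_eq_of_IsFiniteMeasure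
    intro f
    rw [integral_map m1.aemeasurable f.continuous.measurable.aestronglyMeasurable,
      integral_map m1.aemeasurable f.continuous.measurable.aestronglyMeasurable]
    refine (swept_integral_before (P := (P : Measure (I → ℝ))) (c := c) hab
      (g := fun ω => f (ω t)) (f.continuous.measurable.comp m1) ?_
        (fun ω y => by rw [sw_lt ht])).2
    exact (f.compContinuous ⟨fun ω : I → ℝ => ω t, continuous_apply t⟩).integrable _
  · exact (swept_coord hab hi c).2 (lt_irrefl c)
  · intro z
    simp only [ProbabilityMeasure.coe_mk]
    by_cases hz : z ≤ a ∨ b ≤ z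
    · rw [hout c (lt_irrefl c) z hz]
    · push Not at hz
      rw [hin c (lt_irrefl c) z hz.1.le hz.2.le]
      have : ((b - z) * (∫ ω, |ω c - a| ∂(P : Measure (I → ℝ))) +
          (z - a) * (∫ ω, |ω c - b| ∂(P : Measure (I → ℝ)))) / (b - a) =
          ∫ ω, ((b - z) * |ω c - a| + (z - a) * |ω c - b|) / (b - a) ∂(P : Measure (I → ℝ)) := by
        rw [integral_div, integral_add ((hia c a).const_mul _) ((hia c b).const_mul _),
          integral_const_mul, integral_const_mul]
      rw [this]
      refine integral_mono (hia c z)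
        ((((hia c a).const_mul _).add ((hia c b).const_mul _)).div_const _) fun ω => ?_
      show |ω c - z| ≤ ((b - z) * |ω c - a| + (z - a) * |ω c - b|) / (b - a)
      rw [← w_abs_in hab (ω c) z hz.1.le hz.2.le]
      exact w_abs_ge hab _ _
  · exact fun z h1 h2 => hin c (lt_irrefl c) z h1 h2

end sweeping

section strassen

/-- Right sign of `z - x`. -/
noncomputable def sg (z x : ℝ) : ℝ := if x ≤ z then 1 else -1

lemma sg_measurable (z : ℝ) : Measurable (sg z) :=
  Measurable.ite measurableSet_Iic measurable_const measurable_const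

lemma sg_abs (z x : ℝ) : |sg z x| ≤ 1 := by
  unfold sg; split_ifs <;> simp

lemma sg_integrable (ν : Measure ℝ) [IsProbabilityMeasure ν] (z : ℝ) : Integrable (sg z) ν :=
  (integrable_const (1 : ℝ)).mono' (sg_measurable z).aestronglyMeasurable
    (Eventually.of_forall fun x => by rw [Real.norm_eq_abs]; exact sg_abs z x)

lemma sg_integral (ν : Measure ℝ) [IsProbabilityMeasure ν] (z : ℝ) :
    ∫ x, sg z x ∂ν = 2 * ν.real (Iic z) - 1 := by
  have : ∀ x, sg z x = 2 * (Iic z).indicator (fun _ => (1 : ℝ)) x - 1 := by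
    intro x
    unfold sg
    by_cases h : x ≤ z
    · rw [if_pos h, indicator_of_mem (show x ∈ Iic z from h)]; norm_num
    · rw [if_neg h, indicator_of_notMem (show x ∉ Iic z from h)]; norm_num
  simp_rw [this]
  have hi : Integrable ((Iic z).indicator (fun _ => (1 : ℝ))) ν :=
    (integrable_const (1 : ℝ)).indicator measurableSet_Iic
  rw [integral_sub (hi.const_mul 2) (integrable_const 1), integral_const_mul,
    integral_indicator measurableSet_Iic]
  simp

lemma pot_deriv (ν : Measure ℝ) [IsProbabilityMeasure ν] (hν : Integrable (fun x : ℝ => x) ν)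
    (z : ℝ) : Tendsto (fun n : ℕ => ((n : ℝ) + 1) * (pot ν (z + 1 / ((n : ℝ) + 1)) - pot ν z))
      atTop (𝓝 (∫ x, sg z x ∂ν)) := by
  have hi : ∀ w : ℝ, Integrable (fun x : ℝ => |x - w|) ν := fun w =>
    (hν.sub (integrable_const w)).abs
  have h1 : ∀ n : ℕ, ((n : ℝ) + 1) * (pot ν (z + 1 / ((n : ℝ) + 1)) - pot ν z) =
      ∫ x, ((n : ℝ) + 1) * (|x - (z + 1 / ((n : ℝ) + 1))| - |x - z|) ∂ν := by
    intro n
    rw [integral_const_mul, integral_sub (hi _) (hi _)]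
    rfl
  simp_rw [h1]
  refine tendsto_integral_of_dominated_convergence (fun _ => (1 : ℝ)) ?_ (integrable_const 1) ?_ ?_
  · intro n
    exact (((hi _).sub (hi _)).const_mul _).aestronglyMeasurable
  · intro n
    refine Eventually.of_forall fun x => ?_
    have hn : (0 : ℝ) < (n : ℝ) + 1 := by positivity
    rw [Real.norm_eq_abs, abs_mul, abs_of_pos hn]
    have := abs_abs_sub_abs_le_abs_sub (x - (z + 1 / ((n : ℝ) + 1))) (x - z)
    have e : |x - (z + 1 / ((n : ℝ) + 1)) - (x - z)| = 1 / ((n : ℝ) + 1) := by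
      rw [show x - (z + 1 / ((n : ℝ) + 1)) - (x - z) = -(1 / ((n : ℝ) + 1)) by ring, abs_neg,
        abs_of_pos (by positivity)]
    rw [e] at this
    calc ((n : ℝ) + 1) * _ ≤ ((n : ℝ) + 1) * (1 / ((n : ℝ) + 1)) := by gcongr
      _ = 1 := by field_simp
  · refine Eventually.of_forall fun x => ?_
    refine tendsto_const_nhds.congr' ?_
    unfold sg
    by_cases h : x ≤ z
    · rw [if_pos h]
      refine Eventually.of_forall fun n => ?_
      have hn : (0 : ℝ) < 1 / ((n : ℝ) + 1) := by positivity
      dsimp only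
      rw [abs_of_nonpos (by linarith : x - (z + 1 / ((n : ℝ) + 1)) ≤ 0),
        abs_of_nonpos (by linarith : x - z ≤ 0)]
      field_simp
      ring
    · rw [if_neg h]
      push Not at h
      have ht : Tendsto (fun n : ℕ => 1 / ((n : ℝ) + 1)) atTop (𝓝 0) :=
        tendsto_one_div_add_atTop_nhds_zero_nat
      filter_upwards [ht.eventually (gt_mem_nhds (sub_pos.2 h))] with n hn
      rw [abs_of_nonneg (by linarith : 0 ≤ x - (z + 1 / ((n : ℝ) + 1))),
        abs_of_nonneg (by linarith : 0 ≤ x - z)]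
      field_simp
      ring

lemma law_eq (ν ν' : Measure ℝ) [IsProbabilityMeasure ν] [IsProbabilityMeasure ν']
    (hν : Integrable (fun x : ℝ => x) ν) (hν' : Integrable (fun x : ℝ => x) ν')
    (h : ∀ z, pot ν z = pot ν' z) : ν = ν' := by
  refine Measure.ext_of_Iic ν ν' fun z => ?_
  have h1 := pot_deriv ν hν z
  have h2 := pot_deriv ν' hν' z
  simp_rw [h] at h1
  have := tendsto_nhds_unique h1 h2
  rw [sg_integral, sg_integral] at this
  have h3 : ν.real (Iic z) = ν'.real (Iic z) := by linarith
  exact (measureReal_eq_measureReal_iff (by finiteness) (by finiteness)).1 h3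

lemma chord {u : ℝ → ℝ} (hu : Continuous u) {m z0 p v0 : ℝ} (hlow : ∀ z, |z - m| ≤ u z)
    (hp1 : p < 1) (hp2 : -1 < p) (hlt : u z0 < v0) :
    ∃ a b, a < z0 ∧ z0 < b ∧ u a = v0 + p * (a - z0) ∧ u b = v0 + p * (b - z0) := by
  have hg : Continuous fun z => u z - (v0 + p * (z - z0)) := by fun_prop
  have hg0 : (fun z => u z - (v0 + p * (z - z0))) z0 < 0 := by simp; linarith
  have hA : ∃ a, a < z0 ∧ u a = v0 + p * (a - z0) := by
    set Z := min (z0 - 1) ((m - v0 + p * z0) / (1 + p)) with hZ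
    have hZ1 : Z ≤ z0 - 1 := min_le_left _ _
    have hZ2 : Z * (1 + p) ≤ m - v0 + p * z0 := by
      rw [← le_div_iff₀ (by linarith)]; exact min_le_right _ _
    have hZ3 : 0 ≤ (fun z => u z - (v0 + p * (z - z0))) Z := by
      have := hlow Z
      have := neg_abs_le (Z - m)
      dsimp only
      linarith
    obtain ⟨a, ha, hav⟩ := intermediate_value_Icc' (by linarith : Z ≤ z0) hg.continuousOn
      (⟨hg0.le, hZ3⟩ : (0 : ℝ) ∈ Icc _ _)
    dsimp only at hav
    refine ⟨a, lt_of_le_of_ne ha.2 ?_, by linarith⟩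
    rintro rfl
    simp at hav hg0
    linarith
  have hB : ∃ a, z0 < a ∧ u a = v0 + p * (a - z0) := by
    set Z := max (z0 + 1) ((m + v0 - p * z0) / (1 - p)) with hZ
    have hZ1 : z0 + 1 ≤ Z := le_max_left _ _
    have hZ2 : m + v0 - p * z0 ≤ Z * (1 - p) := by
      rw [← div_le_iff₀ (by linarith)]; exact le_max_right _ _
    have hZ3 : 0 ≤ (fun z => u z - (v0 + p * (z - z0))) Z := by
      have := hlow Z
      have := le_abs_self (Z - m)
      dsimp only
      linarith
    obtain ⟨a, ha, hav⟩ := intermediate_value_Icc (by linarith : z0 ≤ Z) hg.continuousOn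
      (⟨hg0.le, hZ3⟩ : (0 : ℝ) ∈ Icc _ _)
    dsimp only at hav
    refine ⟨a, lt_of_le_of_ne ha.1 ?_, by linarith⟩
    rintro rfl
    simp at hav hg0
    linarith
  obtain ⟨a, ha, ha'⟩ := hA
  obtain ⟨b, hb, hb'⟩ := hB
  exact ⟨a, b, ha, hb, ha', hb'⟩

lemma supporting (ν : Measure ℝ) [IsProbabilityMeasure ν] (hν : Integrable (fun x : ℝ => x) ν)
    (z0 : ℝ) (hlt : |z0 - ∫ x, x ∂ν| < pot ν z0) :
    ∃ p : ℝ, p < 1 ∧ -1 < p ∧ ∀ z, pot ν z0 + p * (z - z0) ≤ pot ν z := by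
  have hi : ∀ w : ℝ, Integrable (fun x : ℝ => |x - w|) ν := fun w =>
    (hν.sub (integrable_const w)).abs
  have hs := sg_integrable ν z0
  refine ⟨∫ x, sg z0 x ∂ν, ?_, ?_, ?_⟩
  · by_contra! hcon
    have h0 : ∫ x, (1 - sg z0 x) ∂ν = 0 := by
      apply le_antisymm
      · rw [integral_sub (integrable_const 1) hs]; simpa using hcon
      · exact integral_nonneg fun x => by have := (abs_le.1 (sg_abs z0 x)).2; simp; linarith
    rw [integral_eq_zero_iff_of_nonneg (f := fun x => 1 - sg z0 x)
      (fun x => by have := (abs_le.1 (sg_abs z0 x)).2; simp; linarith)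
      ((integrable_const 1).sub hs)] at h0
    have : pot ν z0 = z0 - ∫ x, x ∂ν := by
      have e : pot ν z0 = ∫ x, (z0 - x) ∂ν := by
        refine integral_congr_ae ?_
        filter_upwards [h0] with x hx
        have hx' : x ≤ z0 := by
          by_contra hc
          simp [sg, hc] at hx
        rw [abs_of_nonpos (by linarith)]; ring
      rw [e, integral_sub (integrable_const _) hν]; simp
    have h2 := le_abs_self (z0 - ∫ x, x ∂ν)
    linarith
  · by_contra! hcon
    have h0 : ∫ x, (1 + sg z0 x) ∂ν = 0 := by
      apply le_antisymm
      · rw [integral_add (integrable_const 1) hs]; simp; linarith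
      · exact integral_nonneg fun x => by have := (abs_le.1 (sg_abs z0 x)).1; simp; linarith
    rw [integral_eq_zero_iff_of_nonneg (f := fun x => 1 + sg z0 x)
      (fun x => by have := (abs_le.1 (sg_abs z0 x)).1; simp; linarith)
      ((integrable_const 1).add hs)] at h0
    have : pot ν z0 = (∫ x, x ∂ν) - z0 := by
      have e : pot ν z0 = ∫ x, (x - z0) ∂ν := by
        refine integral_congr_ae ?_
        filter_upwards [h0] with x hx
        have hx' : z0 ≤ x := by
          by_contra hc
          push Not at hc
          simp [sg, hc.le] at hx
        rw [abs_of_nonneg (by linarith)]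
      rw [e, integral_sub hν (integrable_const _)]; simp
    have h2 := neg_abs_le (z0 - ∫ x, x ∂ν)
    linarith
  · intro z
    have e : pot ν z0 + (∫ x, sg z0 x ∂ν) * (z - z0) = ∫ x, (|x - z0| + sg z0 x * (z - z0)) ∂ν := by
      rw [integral_add (hi z0) (hs.mul_const _), integral_mul_const]; rfl
    rw [e]
    refine integral_mono ((hi z0).add (hs.mul_const _)) (hi z) fun x => ?_
    dsimp only
    unfold sg
    split_ifs with h
    · rw [abs_of_nonpos (by linarith : x - z0 ≤ 0)]
      have := neg_abs_le (x - z); linarith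
    · push Not at h
      rw [abs_of_nonneg (by linarith : 0 ≤ x - z0)]
      have := le_abs_self (x - z); linarith

end strassen

section induction

variable {I : Type*} [Countable I] [LinearOrder I]

lemma MM_mean {ν : Measure ℝ} {P : ProbabilityMeasure (I → ℝ)} (hP : P ∈ MM I ν) (s t : I) :
    ∫ ω, ω s ∂(P : Measure (I → ℝ)) = ∫ ω, ω t ∂(P : Measure (I → ℝ)) := by
  have key : ∀ s t : I, s ≤ t →
      ∫ ω, ω s ∂(P : Measure (I → ℝ)) = ∫ ω, ω t ∂(P : Measure (I → ℝ)) := by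
    intro s t hst
    have := hP.2 s t hst (BoundedContinuousFunction.const _ 1)
    simp only [BoundedContinuousFunction.const_apply, one_mul] at this
    rw [integral_sub (hP.1 t).1 (hP.1 s).1] at this
    linarith
  rcases le_total s t with h | h
  · exact key s t h
  · exact (key t s h).symm

lemma abs_mean_le {Ω : Type*} {mΩ : MeasurableSpace Ω} {P : Measure Ω} [IsProbabilityMeasure P]
    {X : Ω → ℝ} (hX : Integrable X P) (z : ℝ) : |z - ∫ ω, X ω ∂P| ≤ ∫ ω, |X ω - z| ∂P := by
  have e : ∫ ω, (X ω - z) ∂P = (∫ ω, X ω ∂P) - z := by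
    rw [integral_sub hX (integrable_const z)]; simp
  rw [abs_sub_comm, ← e]
  exact abs_integral_le_integral_abs

lemma continuous_pot {Ω : Type*} {mΩ : MeasurableSpace Ω} {P : Measure Ω} [IsProbabilityMeasure P]
    {X : Ω → ℝ} (hX : Integrable X P) : Continuous fun z : ℝ => ∫ ω, |X ω - z| ∂P := by
  have hi : ∀ w : ℝ, Integrable (fun ω => |X ω - w|) P := fun w =>
    (hX.sub (integrable_const w)).abs
  refine LipschitzWith.continuous (K := 1) (LipschitzWith.of_dist_le_mul fun x y => ?_)
  rw [Real.dist_eq, Real.dist_eq, ← integral_sub (hi x) (hi y)]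
  refine abs_integral_le_integral_abs.trans ?_
  have : ∀ ω, |(|X ω - x| - |X ω - y|)| ≤ |x - y| := by
    intro ω
    have := abs_abs_sub_abs_le_abs_sub (X ω - x) (X ω - y)
    rwa [show X ω - x - (X ω - y) = -(x - y) by ring, abs_neg] at this
  calc _ ≤ ∫ _, |x - y| ∂P :=
        integral_mono ((hi x).sub (hi y)).abs (integrable_const _) this
    _ = _ := by simp

lemma improve {ν : Measure ℝ} [IsProbabilityMeasure ν] (hν : Integrable (fun x : ℝ => x) ν)
    {P : ProbabilityMeasure (I → ℝ)} (hP : P ∈ MM I ν) (c : I)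
    (hm : ∫ ω, ω c ∂(P : Measure (I → ℝ)) = ∫ x, x ∂ν) (z0 : ℝ)
    (hlt : ∫ ω, |ω c - z0| ∂(P : Measure (I → ℝ)) < pot ν z0) :
    ∃ P' ∈ MM I ν,
      (∀ t < c, (P' : Measure (I → ℝ)).map (fun ω => ω t) =
        (P : Measure (I → ℝ)).map (fun ω => ω t)) ∧
      (∫ ω, ω c ∂(P' : Measure (I → ℝ)) = ∫ ω, ω c ∂(P : Measure (I → ℝ))) ∧
      (∀ z, ∫ ω, |ω c - z| ∂(P : Measure (I → ℝ)) ≤ ∫ ω, |ω c - z| ∂(P' : Measure (I → ℝ))) ∧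
      ∫ ω, |ω c - z0| ∂(P : Measure (I → ℝ)) < ∫ ω, |ω c - z0| ∂(P' : Measure (I → ℝ)) := by
  have hlow : ∀ z, |z - ∫ x, x ∂ν| ≤ ∫ ω, |ω c - z| ∂(P : Measure (I → ℝ)) := by
    intro z
    rw [← hm]
    exact abs_mean_le (hP.1 c).1 z
  obtain ⟨p, hp1, hp2, hp⟩ := supporting ν hν z0 ((hlow z0).trans_lt hlt)
  obtain ⟨a, b, ha, hb, hua, hub⟩ := chord (continuous_pot (hP.1 c).1) hlow hp1 hp2 hlt
  have hab : a < b := ha.trans hb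
  have hintg : ∀ z, ((b - z) * (∫ ω, |ω c - a| ∂(P : Measure (I → ℝ))) +
      (z - a) * (∫ ω, |ω c - b| ∂(P : Measure (I → ℝ)))) / (b - a) = pot ν z0 + p * (z - z0) := by
    intro z
    rw [hua, hub, div_eq_iff (by linarith)]
    ring
  obtain ⟨P', h1, h2, h3, h4, h5⟩ := sweep hab hP c (fun z _ _ => by rw [hintg]; exact hp z)
  refine ⟨P', h1, h2, h3, h4, ?_⟩
  rw [h5 z0 ha.le hb.le, hintg]
  simpa using hlt

lemma exists_law {ν : ProbabilityMeasure ℝ} (hν : Integrable (fun x : ℝ => x) (ν : Measure ℝ))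
    (c : I) (D : Set I) (hD : ∀ t ∈ D, t < c) (μ : I → ProbabilityMeasure ℝ)
    (hne : ∃ P ∈ MM I (ν : Measure ℝ),
      (∀ t ∈ D, (P : Measure (I → ℝ)).map (fun ω => ω t) = (μ t : Measure ℝ)) ∧
      ∫ ω, ω c ∂(P : Measure (I → ℝ)) = ∫ x, x ∂(ν : Measure ℝ)) :
    ∃ P ∈ MM I (ν : Measure ℝ),
      (∀ t ∈ D, (P : Measure (I → ℝ)).map (fun ω => ω t) = (μ t : Measure ℝ)) ∧
      (P : Measure (I → ℝ)).map (fun ω => ω c) = (ν : Measure ℝ) := by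
  set v := pot (ν : Measure ℝ) with hv
  set u : ProbabilityMeasure (I → ℝ) → ℝ → ℝ :=
    fun P z => ∫ ω, |ω c - z| ∂(P : Measure (I → ℝ)) with hu
  have hunn : ∀ P z, 0 ≤ u P z := fun P z => integral_nonneg fun _ => abs_nonneg _
  set C : Set (ProbabilityMeasure (I → ℝ)) :=
    {P | P ∈ MM I (ν : Measure ℝ) ∧
      (∀ t ∈ D, (P : Measure (I → ℝ)).map (fun ω => ω t) = (μ t : Measure ℝ)) ∧
      ∫ ω, ω c ∂(P : Measure (I → ℝ)) = ∫ x, x ∂(ν : Measure ℝ)} with hC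
  have hCC : IsCompact C := by
    refine (MM_isCompact hν).of_isClosed_subset ?_ fun _ h => h.1
    have e : C = (MM I (ν : Measure ℝ) ∩ (fun P : ProbabilityMeasure (I → ℝ) =>
        ∫ ω, ω c ∂(P : Measure (I → ℝ))) ⁻¹' {∫ x, x ∂(ν : Measure ℝ)}) ∩
        ⋂ t ∈ D, {P : ProbabilityMeasure (I → ℝ) |
          (P : Measure (I → ℝ)).map (fun ω => ω t) = (μ t : Measure ℝ)} := by
      ext P
      rw [hC]
      simp only [mem_inter_iff, mem_preimage, mem_singleton_iff, mem_iInter, Set.mem_ofPred_eq]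
      tauto
    rw [e]
    refine IsClosed.inter ?_ (isClosed_biInter fun t _ => marg_isClosed t (μ t))
    exact ((GG_continuousOn_mean hν c).mono fun _ h => h.1).preimage_isClosed_of_isClosed
      (MM_isClosed hν) isClosed_singleton
  have hCu : ∀ P ∈ C, ∀ z, u P z ≤ v z := fun P hP z => (hP.1.1 c).2 z
  set q := TopologicalSpace.denseSeq ℝ with hq
  have hv0 : ∀ z, 0 ≤ v z := pot_nonneg _
  set w : ℕ → ℝ := fun n => (1 / 2) ^ n / (1 + v (q n)) with hw
  have hwp : ∀ n, 0 < w n := fun n => by have := hv0 (q n); rw [hw]; positivity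
  have hb : ∀ n, ∀ P ∈ C, w n * u P (q n) ≤ (1 / 2 : ℝ) ^ n := by
    intro n P hP
    have h1 := hCu P hP (q n)
    have h0 := hv0 (q n)
    rw [hw]
    dsimp only
    rw [div_mul_eq_mul_div, div_le_iff₀ (by linarith)]
    gcongr
    linarith
  have hb' : ∀ n, ∀ P ∈ C, ‖w n * u P (q n)‖ ≤ (1 / 2 : ℝ) ^ n := by
    intro n P hP
    rw [Real.norm_of_nonneg (mul_nonneg (hwp n).le (hunn _ _))]
    exact hb n P hP
  have hFc : ContinuousOn (fun P => ∑' n, w n * u P (q n)) C :=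
    continuousOn_tsum (fun n => ContinuousOn.mul continuousOn_const
      ((GG_continuousOn_pot hν c (q n)).mono fun _ h => h.1.1))
      summable_geometric_two hb'
  obtain ⟨P, hP, hmax⟩ := hCC.exists_isMaxOn hne hFc
  have hsum : ∀ P ∈ C, Summable fun n => w n * u P (q n) := fun P hP =>
    Summable.of_norm_bounded summable_geometric_two fun n => hb' n P hP
  have hqe : ∀ n, u P (q n) = v (q n) := by
    intro n
    by_contra hcon
    have hlt := lt_of_le_of_ne (hCu P hP _) hcon
    obtain ⟨P', h1, h2, h3, h4, h5⟩ := improve hν hP.1 c hP.2.2 (q n) hlt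
    have hP' : P' ∈ C := ⟨h1, fun t ht => (h2 t (hD t ht)).trans (hP.2.1 t ht), h3.trans hP.2.2⟩
    have hm := hmax hP'
    have := Summable.tsum_lt_tsum (i := n)
      (fun k => mul_le_mul_of_nonneg_left (h4 (q k)) (hwp k).le)
      (mul_lt_mul_of_pos_left h5 (hwp n)) (hsum P hP) (hsum P' hP')
    exact absurd hm (not_le.2 this)
  have hall : u P = v := by
    refine Continuous.ext_on (TopologicalSpace.denseRange_denseSeq ℝ)
      (continuous_pot (hP.1.1 c).1) (continuous_pot hν) ?_
    rintro _ ⟨n, rfl⟩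
    exact hqe n
  refine ⟨P, hP.1, hP.2.1, ?_⟩
  have hmp : IsProbabilityMeasure ((P : Measure (I → ℝ)).map (fun ω => ω c)) :=
    Measure.isProbabilityMeasure_map (measurable_pi_apply c).aemeasurable
  refine law_eq _ _ ?_ hν fun z => ?_
  · exact (integrable_map_measure (f := fun ω : I → ℝ => ω c) (g := fun x : ℝ => x)
      (by fun_prop) (measurable_pi_apply c).aemeasurable).2
      (hP.1.1 c).1
  · unfold pot
    rw [integral_map (measurable_pi_apply c).aemeasurable (by fun_prop)]
    exact congrFun hall z

lemma pot_mono {μ ν : Measure ℝ} [IsProbabilityMeasure μ] [IsProbabilityMeasure ν]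
    (hμ : Integrable (fun x : ℝ => x) μ) (hν : Integrable (fun x : ℝ => x) ν)
    (h : ConvexOrder μ ν) (z : ℝ) : pot μ z ≤ pot ν z := by
  refine h (fun x => |x - z|) ?_ (hμ.sub (integrable_const z)).abs (hν.sub (integrable_const z)).abs
  have := (convexOn_univ_norm (E := ℝ)).translate_left (-z)
  simpa [Function.comp_def, Real.norm_eq_abs, sub_eq_add_neg] using this

lemma mean_eq {μ ν : Measure ℝ}
    (hμ : Integrable (fun x : ℝ => x) μ) (hν : Integrable (fun x : ℝ => x) ν)
    (h : ConvexOrder μ ν) : ∫ x, x ∂μ = ∫ x, x ∂ν := by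
  apply le_antisymm
  · exact h (fun x => x) (convexOn_id convex_univ) hμ hν
  · have := h (fun x => -x) ((concaveOn_id convex_univ).neg) hμ.neg hν.neg
    rw [integral_neg, integral_neg] at this
    linarith

lemma MM_mono {μ ν : Measure ℝ} (h : ∀ z, pot μ z ≤ pot ν z) : MM I μ ⊆ MM I ν :=
  fun _ hP => ⟨fun t => ⟨(hP.1 t).1, fun z => ((hP.1 t).2 z).trans (h z)⟩, hP.2⟩

lemma dirac_MM (ν : Measure ℝ) [IsProbabilityMeasure ν] (hν : Integrable (fun x : ℝ => x) ν) :
    ∃ P ∈ MM I ν, ∀ t, ∫ ω, ω t ∂(P : Measure (I → ℝ)) = ∫ x, x ∂ν := by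
  set m := ∫ x, x ∂ν with hm
  refine ⟨⟨Measure.dirac (fun _ => m), inferInstance⟩, ⟨fun t => ⟨?_, fun z => ?_⟩, ?_⟩, ?_⟩
  · simp only [ProbabilityMeasure.coe_mk]
    exact integrable_dirac (by simp)
  · simp only [ProbabilityMeasure.coe_mk]
    rw [integral_dirac' _ _ (by fun_prop : Measurable fun ω : I → ℝ => |ω t - z|).stronglyMeasurable]
    rw [abs_sub_comm]
    exact abs_mean_le hν z
  · intro s t _ f
    simp only [ProbabilityMeasure.coe_mk]
    have hfm : Measurable fun ω : I → ℝ => f (rst s ω) :=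
      (f.continuous.comp (rst_continuous s)).measurable
    have hgm : Measurable fun ω : I → ℝ => f (rst s ω) * (ω t - ω s) :=
      hfm.mul ((measurable_pi_apply t).sub (measurable_pi_apply s))
    rw [integral_dirac' _ _ hgm.stronglyMeasurable]
    simp
  · intro t
    simp only [ProbabilityMeasure.coe_mk]
    have hgm : Measurable fun ω : I → ℝ => ω t := measurable_pi_apply t
    rw [integral_dirac' _ _ hgm.stronglyMeasurable]

lemma exists_MM (μ : I → ProbabilityMeasure ℝ)
    (hintg : ∀ t, Integrable (fun x : ℝ => x) (μ t : Measure ℝ))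
    (hco : ∀ s t : I, s ≤ t → ConvexOrder (μ s : Measure ℝ) (μ t : Measure ℝ)) (D : Finset I) :
    ∀ a, (∀ d ∈ D, d ≤ a) → ∃ P ∈ MM I (μ a : Measure ℝ),
      (∀ t ∈ D, (P : Measure (I → ℝ)).map (fun ω => ω t) = (μ t : Measure ℝ)) ∧
      ∀ t, ∫ ω, ω t ∂(P : Measure (I → ℝ)) = ∫ x, x ∂(μ a : Measure ℝ) := by
  induction D using Finset.induction_on_max with
  | empty =>
    intro a _
    obtain ⟨P, h1, h2⟩ := dirac_MM (I := I) (μ a : Measure ℝ) (hintg a)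
    exact ⟨P, h1, by simp, h2⟩
  | insert c D hc ih =>
    intro a ha
    obtain ⟨P, h1, h2, h3⟩ := ih c fun d hd => (hc d hd).le
    obtain ⟨P', h1', h2', h3'⟩ := exists_law (hintg c) c (D : Set I)
      (fun t ht => hc t (by simpa using ht)) μ ⟨P, h1, fun t ht => h2 t (by simpa using ht), h3 c⟩
    have hca : c ≤ a := ha c (by simp)
    refine ⟨P', MM_mono (pot_mono (hintg c) (hintg a) (hco c a hca)) h1', ?_, ?_⟩
    · intro t ht
      rcases Finset.mem_insert.1 ht with rfl | ht
      · exact h3'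
      · exact h2' t (by simpa using ht)
    · intro t
      rw [MM_mean h1' t c, ← mean_eq (hintg c) (hintg a) (hco c a hca), ← h3',
        integral_map (measurable_pi_apply c).aemeasurable (by fun_prop)]

end induction

lemma MQ_eq (Q : Set ℝ) [Countable ↥Q] (hQ : Q ⊆ Icc (0 : ℝ) 1) (h1Q : (1 : ℝ) ∈ Q)
    (μ : ↥Q → ProbabilityMeasure ℝ) (D : Set ↥Q) (h1 : (⟨1, h1Q⟩ : ↥Q) ∈ D) :
    MQ Q D μ = MM ↥Q (μ ⟨1, h1Q⟩ : Measure ℝ) ∩ ⋂ t ∈ D, {P : ProbabilityMeasure (↥Q → ℝ) |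
      (P : Measure (↥Q → ℝ)).map (fun ω => ω t) = (μ t : Measure ℝ)} := by
  ext P
  simp only [MQ, mem_inter_iff, mem_iInter, Set.mem_ofPred_eq]
  refine and_congr_left fun hD => ⟨fun h => ⟨fun t => ⟨h.integrable t, fun z => ?_⟩,
    MC_of_martingale h⟩, fun h => martingale_of_MC (fun t => (h.1 t).1) h.2⟩
  have ht : t ≤ ⟨1, h1Q⟩ := (hQ t.2).2
  have hle := (natFiltration ↥Q).le t
  have h2 : (P : Measure (↥Q → ℝ))[fun ω : ↥Q → ℝ => ω ⟨1, h1Q⟩ - z | natFiltration ↥Q t]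
      =ᵐ[(P : Measure (↥Q → ℝ))] fun ω => ω t - z := by
    have e := condExp_sub (m := natFiltration ↥Q t) (h.integrable ⟨1, h1Q⟩)
      (integrable_const (μ := (P : Measure (↥Q → ℝ))) z)
    refine e.trans ?_
    rw [condExp_const hle z]
    filter_upwards [h.2 t ⟨1, h1Q⟩ ht] with ω hω
    simp only [Pi.sub_apply]
    rw [hω]
  have e1 : pot (μ ⟨1, h1Q⟩ : Measure ℝ) z =
      ∫ ω, |ω ⟨1, h1Q⟩ - z| ∂(P : Measure (↥Q → ℝ)) := by
    unfold pot
    rw [← hD _ h1, integral_map (measurable_pi_apply _).aemeasurable (by fun_prop)]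
  rw [e1]
  have h3 := integral_abs_condExp_le (m := natFiltration ↥Q t) (μ := (P : Measure (↥Q → ℝ)))
    (fun ω : ↥Q → ℝ => ω ⟨1, h1Q⟩ - z)
  refine le_trans (le_of_eq ?_) h3
  refine integral_congr_ae ?_
  filter_upwards [h2] with ω hω
  rw [hω]


/-- for a countable `Q ⊆ [0,1]` with `1 ∈ Q` and a peacock `(μ_t)_{t ∈ Q}`,
for every finite `D ⊆ Q` containing `1` the set `M_Q((μ_t)_{t∈D})` is nonempty and compact
in the weak topology, and consequently so is `M((μ_t)_{t∈Q}) = ⋂_D M_Q((μ_t)_{t∈D})`. -/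
theorem MQ_nonempty_compact
    (Q : Set ℝ) [Countable ↥Q] (hQ : Q ⊆ Icc (0 : ℝ) 1) (h1Q : (1 : ℝ) ∈ Q)
    (μ : ↥Q → ProbabilityMeasure ℝ)
    (hmom : ∀ t, Integrable (fun x => |x|) (μ t : Measure ℝ))
    (hpeacock : ∀ s t : ↥Q, s ≤ t → ConvexOrder (μ s : Measure ℝ) (μ t : Measure ℝ)) :
    (∀ D : Set ↥Q, D.Finite → (⟨1, h1Q⟩ : ↥Q) ∈ D →
      (MQ Q D μ).Nonempty ∧ IsCompact (MQ Q D μ)) ∧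
    ((MQ Q Set.univ μ).Nonempty ∧ IsCompact (MQ Q Set.univ μ) ∧
      MQ Q Set.univ μ = ⋂ (D : Set ↥Q) (_ : D.Finite) (_ : (⟨1, h1Q⟩ : ↥Q) ∈ D), MQ Q D μ) := by
  have hintg : ∀ t, Integrable (fun x : ℝ => x) (μ t : Measure ℝ) := fun t =>
    (integrable_norm_iff (f := fun x : ℝ => x) (by fun_prop)).1 (hmom t)
  have hcl : ∀ D : Set ↥Q, (⟨1, h1Q⟩ : ↥Q) ∈ D → IsClosed (MQ Q D μ) := by
    intro D h1
    rw [MQ_eq Q hQ h1Q μ D h1]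
    exact (MM_isClosed (hintg _)).inter (isClosed_biInter fun t _ => marg_isClosed t (μ t))
  have hcp : ∀ D : Set ↥Q, (⟨1, h1Q⟩ : ↥Q) ∈ D → IsCompact (MQ Q D μ) := by
    intro D h1
    refine (MM_isCompact (I := ↥Q) (hintg ⟨1, h1Q⟩)).of_isClosed_subset (hcl D h1) ?_
    rw [MQ_eq Q hQ h1Q μ D h1]
    exact inter_subset_left
  have hne : ∀ D : Set ↥Q, D.Finite → (⟨1, h1Q⟩ : ↥Q) ∈ D → (MQ Q D μ).Nonempty := by
    intro D hD h1
    obtain ⟨P, hP1, hP2, -⟩ := exists_MM μ hintg hpeacock hD.toFinset ⟨1, h1Q⟩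
      fun d _ => (hQ d.2).2
    refine ⟨P, ?_⟩
    rw [MQ_eq Q hQ h1Q μ D h1]
    exact ⟨hP1, mem_iInter₂.2 fun t ht => hP2 t (by simpa using ht)⟩
  have heq : MQ Q Set.univ μ =
      ⋂ (D : Set ↥Q) (_ : D.Finite) (_ : (⟨1, h1Q⟩ : ↥Q) ∈ D), MQ Q D μ := by
    ext P
    simp only [mem_iInter]
    constructor
    · intro h D _ _
      exact ⟨h.1, fun t _ => h.2 t (mem_univ t)⟩
    · intro h
      refine ⟨(h {⟨1, h1Q⟩} (Set.finite_singleton _) rfl).1, fun t _ => ?_⟩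
      exact (h {⟨1, h1Q⟩, t} (Set.toFinite _) (by simp)).2 t (by simp)
  refine ⟨fun D hD h1 => ⟨hne D hD h1, hcp D h1⟩, ?_, hcp _ (mem_univ _), heq⟩
  let J := {D : Set ↥Q // D.Finite ∧ (⟨1, h1Q⟩ : ↥Q) ∈ D}
  have hJ : Nonempty J := ⟨⟨{⟨1, h1Q⟩}, Set.finite_singleton _, rfl⟩⟩
  have hdir := IsCompact.nonempty_iInter_of_directed_nonempty_isCompact_isClosed
    (fun j : J => MQ Q j.1 μ)
    (fun i j => ⟨⟨i.1 ∪ j.1, i.2.1.union j.2.1, Or.inl i.2.2⟩,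
      fun P hP => ⟨hP.1, fun t ht => hP.2 t (Or.inl ht)⟩,
      fun P hP => ⟨hP.1, fun t ht => hP.2 t (Or.inr ht)⟩⟩)
    (fun j => hne j.1 j.2.1 j.2.2) (fun j => hcp j.1 j.2.2) (fun j => hcl j.1 j.2.2)
  obtain ⟨P, hP⟩ := hdir
  refine ⟨P, ?_⟩
  rw [heq]
  simp only [mem_iInter]
  intro D hD h1
  exact mem_iInter.1 hP ⟨D, hD, h1⟩
end

section
/- Let (X_n)_{n ∈ −ℕ ∪ {−∞}} be a backward martingale with respect to a filtration (G_n), with laws μ_n = Law(X_n). If μ_n converges weakly to μ_{−∞} as n → −∞, then X_n → X_{−∞} almost surely and in L¹ as n → −∞. -/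
open MeasureTheory Filter Topology

/-- The Bregman divergence of `x ↦ √(1+x²)`. -/
noncomputable def bregAux (x y : ℝ) : ℝ :=
  √(1 + x ^ 2) - √(1 + y ^ 2) - y / √(1 + y ^ 2) * (x - y)

lemma bregAux_key (x y : ℝ) :
    0 ≤ bregAux x y ∧ (x - y) ^ 2 ≤ 2 * √(1 + x ^ 2) * (1 + y ^ 2) * bregAux x y := by
  have ha : 0 < √(1 + x ^ 2) := by positivity
  have hb : 0 < √(1 + y ^ 2) := by positivity
  have ha2 : √(1 + x ^ 2) ^ 2 = 1 + x ^ 2 := Real.sq_sqrt (by positivity)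
  have hb2 : √(1 + y ^ 2) ^ 2 = 1 + y ^ 2 := Real.sq_sqrt (by positivity)
  unfold bregAux
  set a := √(1 + x ^ 2)
  set b := √(1 + y ^ 2)
  have hD : a - b - y / b * (x - y) = (a * b - (1 + x * y)) / b := by
    field_simp
    nlinarith
  have hsq : (a * b) ^ 2 - (1 + x * y) ^ 2 = (x - y) ^ 2 := by
    rw [mul_pow, ha2, hb2]; ring
  have hab : 1 + x * y ≤ a * b := by
    exact (abs_le_of_sq_le_sq' (by nlinarith [sq_nonneg (x - y)]) (by positivity)).2
  rw [hD, ← hb2]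
  refine ⟨div_nonneg (by linarith) hb.le, ?_⟩
  have : 2 * a * b ^ 2 * ((a * b - (1 + x * y)) / b) = 2 * (a * b) * (a * b - (1 + x * y)) := by
    field_simp
  rw [this]
  nlinarith [sq_nonneg (a * b - (1 + x * y))]

lemma sqrt_one_add_sq_le (x : ℝ) : √(1 + x ^ 2) ≤ |x| + 1 := by
  apply Real.sqrt_le_iff.2
  refine ⟨by positivity, ?_⟩
  nlinarith [sq_abs x, abs_nonneg x]

lemma bregAux_tendsto (x : ℕ → ℝ) (y : ℝ)
    (h : Tendsto (fun n => bregAux (x n) y) atTop (𝓝 0)) : Tendsto x atTop (𝓝 y) := by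
  have h1 : ∀ n, (x n - y) ^ 2 ≤ 2 * (2 * (1 + y ^ 2) * (2 + |y|) * bregAux (x n) y) +
      (2 * (1 + y ^ 2) * (2 + |y|) * bregAux (x n) y) ^ 2 := by
    intro n
    obtain ⟨h0, hk⟩ := bregAux_key (x n) y
    have h2 := sqrt_one_add_sq_le (x n)
    have h3 : |x n| ≤ |y| + |x n - y| := by
      have := abs_add_le y (x n - y); simpa using this
    have h4 : |x n| + 1 ≤ (2 + |y|) * (1 + |x n - y|) := by
      nlinarith [abs_nonneg y, abs_nonneg (x n - y), mul_nonneg (abs_nonneg y) (abs_nonneg (x n - y))]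
    set t := |x n - y|
    have ht2 : t ^ 2 = (x n - y) ^ 2 := sq_abs _
    have h5 : (x n - y) ^ 2 ≤ (2 * (1 + y ^ 2) * (2 + |y|) * bregAux (x n) y) * (1 + t) := by
      refine hk.trans ?_
      have : 0 ≤ 2 * (1 + y ^ 2) * bregAux (x n) y := by positivity
      nlinarith [mul_le_mul_of_nonneg_left (h2.trans h4) this]
    set s := 2 * (1 + y ^ 2) * (2 + |y|) * bregAux (x n) y
    nlinarith [sq_nonneg (s - t)]
  have h2 : Tendsto (fun n => 2 * (2 * (1 + y ^ 2) * (2 + |y|) * bregAux (x n) y) +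
      (2 * (1 + y ^ 2) * (2 + |y|) * bregAux (x n) y) ^ 2) atTop (𝓝 0) := by
    have h3 := h.const_mul (2 * (1 + y ^ 2) * (2 + |y|))
    have := (h3.const_mul 2).add (h3.pow 2)
    simpa using this
  have h3 := squeeze_zero (fun n => sq_nonneg (x n - y)) h1 h2
  have h4 : Tendsto (fun n => √((x n - y) ^ 2)) atTop (𝓝 0) := by
    simpa using h3.sqrt
  simp only [Real.sqrt_sq_eq_abs] at h4
  have h5 := (tendsto_zero_iff_abs_tendsto_zero _).2 h4
  exact tendsto_sub_nhds_zero_iff.1 h5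

/-- The convex tail function. -/
noncomputable def tailAux (M : ℝ) (x : ℝ) : ℝ := max (|x| + (1 - M)) 0

lemma tailAux_convex (M : ℝ) : ConvexOn ℝ Set.univ (tailAux M) := by
  have h : ConvexOn ℝ Set.univ (fun x : ℝ => |x| + (1 - M)) :=
    (convexOn_univ_norm (E := ℝ)).add (convexOn_const _ convex_univ)
  exact h.sup (convexOn_const 0 convex_univ)

lemma tailAux_cont (M : ℝ) : Continuous (tailAux M) := by
  unfold tailAux; fun_prop

lemma tailAux_integrable {Ω : Type*} {m : MeasurableSpace Ω} {ℙ : Measure Ω}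
    [IsProbabilityMeasure ℙ] (M : ℝ) {X : Ω → ℝ} (hX : Integrable X ℙ) :
    Integrable (fun ω => tailAux M (X ω)) ℙ :=
  (hX.abs.add (integrable_const (1 - M))).sup (integrable_zero _ _ _)

lemma tailAux_tendsto {Ω : Type*} {m : MeasurableSpace Ω} {ℙ : Measure Ω}
    [IsProbabilityMeasure ℙ] {X : Ω → ℝ} (hX : Integrable X ℙ) :
    Tendsto (fun n : ℕ => ∫ ω, tailAux (n + 1) (X ω) ∂ℙ) atTop (𝓝 0) := by
  have : Tendsto (fun n : ℕ => ∫ ω, tailAux (n + 1) (X ω) ∂ℙ) atTop (𝓝 (∫ _, (0 : ℝ) ∂ℙ)) := by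
    refine tendsto_integral_of_dominated_convergence (fun ω => |X ω|)
      (fun n => (tailAux_integrable _ hX).aestronglyMeasurable) hX.abs ?_ ?_
    · intro n
      refine ae_of_all _ fun ω => ?_
      have hn : (0 : ℝ) ≤ n := n.cast_nonneg
      rw [Real.norm_eq_abs, tailAux, abs_of_nonneg (le_max_right _ _)]
      exact max_le (by linarith) (abs_nonneg _)
    · refine ae_of_all _ fun ω => ?_
      apply tendsto_const_nhds.congr'
      obtain ⟨N, hN⟩ := exists_nat_ge |X ω|
      filter_upwards [eventually_ge_atTop N] with n hn
      have : (N : ℝ) ≤ n := by exact_mod_cast hn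
      rw [tailAux, max_eq_right (by linarith)]
  simpa using this

lemma maxAux {Ω : Type*} {m : MeasurableSpace Ω} {ℙ : Measure Ω} [IsProbabilityMeasure ℙ]
    (G : ℕ → MeasurableSpace Ω) (hGanti : Antitone G) (hGle : ∀ k, G k ≤ m)
    (Z : ℕ → Ω → ℝ) (hadapt : ∀ k, StronglyMeasurable[G k] (Z k))
    (hint : ∀ k, Integrable (Z k) ℙ)
    (hmart : ∀ k l, k ≤ l → ℙ[Z k | G l] =ᵐ[ℙ] Z l) (ε : NNReal) (k : ℕ) :
    ε * ℙ {ω | ∃ j, k ≤ j ∧ (ε : ℝ) ≤ |Z j ω|} ≤ ENNReal.ofReal (∫ ω, |Z k ω| ∂ℙ) := by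
  have hN : ∀ N, ε * ℙ {ω | ∃ j, k ≤ j ∧ j ≤ k + N ∧ (ε : ℝ) ≤ |Z j ω|} ≤
      ENNReal.ofReal (∫ ω, |Z k ω| ∂ℙ) := by
    intro N
    let F : Filtration ℕ m :=
      { seq := fun j => G (k + (N - j))
        mono' := fun i j hij => hGanti (by omega)
        le' := fun i => hGle _ }
    have hM : Martingale (fun j => Z (k + (N - j))) F ℙ :=
      ⟨fun j => hadapt _, fun i j hij => hmart _ _ (by omega)⟩
    have hS := hM.submartingale.sup hM.neg.submartingale
    have hmax := maximal_ineq hS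
      (fun j ω => by
        change 0 ≤ max (Z (k + (N - j)) ω) (-Z (k + (N - j)) ω)
        exact abs_nonneg (Z (k + (N - j)) ω)) (ε := ε) N
    refine le_trans ?_ (hmax.trans ?_)
    · gcongr with ω
      rintro ⟨j, hj1, hj2, hj3⟩
      refine (hj3.trans ?_ : (ε : ℝ) ≤ _)
      refine le_trans (le_of_eq ?_) (Finset.le_sup' _
        (b := N - (j - k)) (Finset.mem_range.2 (by omega)))
      have : k + (N - (N - (j - k))) = j := by omega
      change _ = max (Z (k + (N - (N - (j - k)))) ω) (-Z (k + (N - (N - (j - k)))) ω)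
      rw [this]; rfl
    · apply ENNReal.ofReal_le_ofReal
      have : ∀ ω, ((fun j => Z (k + (N - j))) ⊔ -fun j => Z (k + (N - j))) N ω = |Z k ω| := by
        intro ω
        change max (Z (k + (N - N)) ω) (-Z (k + (N - N)) ω) = _
        simp [abs]
      simp only [this]
      exact setIntegral_le_integral (hint k).abs (ae_of_all _ fun ω => abs_nonneg _)
  have hU : {ω | ∃ j, k ≤ j ∧ (ε : ℝ) ≤ |Z j ω|} =
      ⋃ N, {ω | ∃ j, k ≤ j ∧ j ≤ k + N ∧ (ε : ℝ) ≤ |Z j ω|} := by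
    ext ω
    simp only [Set.mem_ofPred_eq, Set.mem_iUnion]
    constructor
    · rintro ⟨j, h1, h2⟩
      exact ⟨j, j, h1, by omega, h2⟩
    · rintro ⟨N, j, h1, _, h2⟩
      exact ⟨j, h1, h2⟩
  rw [hU, Monotone.measure_iUnion, ENNReal.mul_iSup]
  · exact iSup_le hN
  · rintro N N' h ω ⟨j, h1, h2, h3⟩
    exact ⟨j, h1, by omega, h3⟩

lemma aeAux {Ω : Type*} {m : MeasurableSpace Ω} {ℙ : Measure Ω} [IsProbabilityMeasure ℙ]
    (G : ℕ → MeasurableSpace Ω) (hGanti : Antitone G) (hGle : ∀ k, G k ≤ m)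
    (Z : ℕ → Ω → ℝ) (hadapt : ∀ k, StronglyMeasurable[G k] (Z k))
    (hint : ∀ k, Integrable (Z k) ℙ)
    (hmart : ∀ k l, k ≤ l → ℙ[Z k | G l] =ᵐ[ℙ] Z l)
    (hL : Tendsto (fun k => ∫ ω, |Z k ω| ∂ℙ) atTop (𝓝 0)) :
    ∀ᵐ ω ∂ℙ, Tendsto (fun k => Z k ω) atTop (𝓝 0) := by
  have hε : ∀ n : ℕ, ∀ᵐ ω ∂ℙ, ∃ k, ∀ j, k ≤ j → |Z j ω| < 1 / ((n : ℝ) + 1) := by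
    intro n
    set ε : NNReal := 1 / ((n : NNReal) + 1) with hεdef
    have hεpos : (ε : ENNReal) ≠ 0 := by
      have : 0 < ε := by positivity
      exact_mod_cast this.ne'
    have hεr : (ε : ℝ) = 1 / ((n : ℝ) + 1) := by simp [hεdef]
    rw [ae_iff]
    set S := {ω | ¬∃ k, ∀ j, k ≤ j → |Z j ω| < 1 / ((n : ℝ) + 1)}
    have h1 : ∀ k, ε * ℙ S ≤ ENNReal.ofReal (∫ ω, |Z k ω| ∂ℙ) := by
      intro k
      refine le_trans ?_ (maxAux G hGanti hGle Z hadapt hint hmart ε k)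
      gcongr
      intro ω hω
      simp only [S, Set.mem_ofPred_eq] at hω
      push Not at hω
      obtain ⟨j, hj, hj'⟩ := hω k
      exact ⟨j, hj, by rw [hεr]; exact hj'⟩
    have h2 : Tendsto (fun k => ENNReal.ofReal (∫ ω, |Z k ω| ∂ℙ)) atTop (𝓝 0) := by
      simpa using ENNReal.tendsto_ofReal hL
    have h3 : ε * ℙ S ≤ 0 := ge_of_tendsto' h2 h1
    rcases mul_eq_zero.1 (le_antisymm h3 bot_le) with h | h
    · exact absurd h hεpos
    · exact h
  filter_upwards [ae_all_iff.2 hε] with ω hω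
  rw [Metric.tendsto_atTop]
  intro δ hδ
  obtain ⟨n, hn⟩ := exists_nat_one_div_lt hδ
  obtain ⟨k, hk⟩ := hω n
  refine ⟨k, fun j hj => ?_⟩
  rw [Real.dist_eq, sub_zero]
  exact (hk j hj).trans hn

/-- backward martingale convergence towards the time `−∞` element.
We index `−ℕ` by `k ∈ ℕ` via `n = −k`, so `k → ∞` corresponds to `n → −∞`; thus the
filtration `G` is antitone in `k` and the martingale property reads
`E[X_k | G_l] = X_l` for `k ≤ l`.  If the laws of `X_k` converge weakly to the law of
`X_∞` (the time `−∞` random variable, measurable w.r.t. `G_∞ ≤ G_k` with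
`E[X_k | G_∞] = X_∞`), then `X_k → X_∞` almost surely and in `L¹`. -/
theorem backward_martingale_limit_identification
    {Ω : Type*} {m : MeasurableSpace Ω} {ℙ : Measure Ω} [IsProbabilityMeasure ℙ]
    (G : ℕ → MeasurableSpace Ω) (Ginf : MeasurableSpace Ω)
    (hGanti : Antitone G) (hGle : ∀ k, G k ≤ m) (hGinf : ∀ k, Ginf ≤ G k)
    (X : ℕ → Ω → ℝ) (Xinf : Ω → ℝ)
    (hadapt : ∀ k, StronglyMeasurable[G k] (X k))
    (hint : ∀ k, Integrable (X k) ℙ)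
    (hXinf_meas : StronglyMeasurable[Ginf] Xinf)
    (hXinf_int : Integrable Xinf ℙ)
    (hmart : ∀ k l, k ≤ l → ℙ[X k | G l] =ᵐ[ℙ] X l)
    (hmartinf : ∀ k, ℙ[X k | Ginf] =ᵐ[ℙ] Xinf)
    (hweak : ∀ f : BoundedContinuousFunction ℝ ℝ,
      Tendsto (fun k => ∫ ω, f (X k ω) ∂ℙ) atTop (𝓝 (∫ ω, f (Xinf ω) ∂ℙ))) :
    (∀ᵐ ω ∂ℙ, Tendsto (fun k => X k ω) atTop (𝓝 (Xinf ω))) ∧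
    Tendsto (fun k => ∫ ω, |X k ω - Xinf ω| ∂ℙ) atTop (𝓝 0) := by
  have hXm : Ginf ≤ m := (hGinf 0).trans (hGle 0)
  -- Jensen for the tails
  have htail : ∀ M k, ∫ ω, tailAux M (X k ω) ∂ℙ ≤ ∫ ω, tailAux M (X 0 ω) ∂ℙ := by
    intro M k
    have hJ := (tailAux_convex M).map_condExp_le_of_finiteDimensional (hGle k) (hint 0)
      (tailAux_integrable M (hint 0))
    have h1 : (fun ω => tailAux M (X k ω)) ≤ᵐ[ℙ] ℙ[tailAux M ∘ X 0 | G k] := by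
      filter_upwards [hJ, hmart 0 k (Nat.zero_le k)] with ω h1 h2
      simpa [h2] using h1
    calc ∫ ω, tailAux M (X k ω) ∂ℙ ≤ ∫ ω, (ℙ[tailAux M ∘ X 0 | G k]) ω ∂ℙ :=
          integral_mono_ae (tailAux_integrable M (hint k)) integrable_condExp h1
      _ = ∫ ω, tailAux M (X 0 ω) ∂ℙ := integral_condExp (hGle k)
  -- integrability of `φ(Y)`
  have hphi : ∀ Y : Ω → ℝ, Integrable Y ℙ → Integrable (fun ω => √(1 + (Y ω) ^ 2)) ℙ := by
    intro Y hY
    refine (hY.abs.add (integrable_const (1 : ℝ))).mono' ?_ ?_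
    · exact (by fun_prop : Continuous fun x : ℝ => √(1 + x ^ 2)).comp_aestronglyMeasurable
        hY.aestronglyMeasurable
    · refine ae_of_all _ fun ω => ?_
      rw [Real.norm_eq_abs, abs_of_nonneg (Real.sqrt_nonneg _)]
      exact sqrt_one_add_sq_le _
  -- cross term
  have hcm : Continuous fun y : ℝ => y / √(1 + y ^ 2) :=
    continuous_id.div (by fun_prop) (fun y => by positivity)
  have hcs : StronglyMeasurable[Ginf] (fun ω => Xinf ω / √(1 + Xinf ω ^ 2)) :=
    hcm.comp_stronglyMeasurable hXinf_meas
  have hcb : ∀ y : ℝ, ‖y / √(1 + y ^ 2)‖ ≤ 1 := by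
    intro y
    rw [norm_div, Real.norm_eq_abs, Real.norm_eq_abs, abs_of_nonneg (Real.sqrt_nonneg _)]
    refine div_le_one_of_le₀ (Real.abs_le_sqrt (by linarith)) (Real.sqrt_nonneg _)
  have hZint : ∀ k, Integrable (fun ω => X k ω - Xinf ω) ℙ := fun k => (hint k).sub hXinf_int
  have hcint : ∀ k, Integrable (fun ω => Xinf ω / √(1 + Xinf ω ^ 2) * (X k ω - Xinf ω)) ℙ :=
    fun k => (hZint k).bdd_mul (hcs.mono hXm).aestronglyMeasurable (ae_of_all _ fun ω => hcb _)
  have hcross : ∀ k, ∫ ω, Xinf ω / √(1 + Xinf ω ^ 2) * (X k ω - Xinf ω) ∂ℙ = 0 := by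
    intro k
    have h1 := condExp_mul_of_stronglyMeasurable_left (μ := ℙ) hcs (hcint k) (hZint k)
    have h2 := condExp_sub (hint k) hXinf_int Ginf
    have h3 := condExp_of_stronglyMeasurable hXm hXinf_meas hXinf_int
    rw [← integral_condExp hXm]
    apply integral_eq_zero_of_ae
    filter_upwards [h1, h2, hmartinf k] with ω h1 h2 h4
    refine h1.trans ?_
    have h5 : (ℙ[fun ω => X k ω - Xinf ω | Ginf]) ω = 0 := by
      refine h2.trans ?_
      simp [h3, h4]
    simp [h5]
  have hDint : ∀ k, Integrable (fun ω => bregAux (X k ω) (Xinf ω)) ℙ := fun k =>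
    ((hphi _ (hint k)).sub (hphi _ hXinf_int)).sub (hcint k)
  have hDeq : ∀ k, ∫ ω, bregAux (X k ω) (Xinf ω) ∂ℙ =
      ∫ ω, √(1 + X k ω ^ 2) ∂ℙ - ∫ ω, √(1 + Xinf ω ^ 2) ∂ℙ := by
    intro k
    unfold bregAux
    have hs : Integrable (fun ω => √(1 + X k ω ^ 2) - √(1 + Xinf ω ^ 2)) ℙ :=
      (hphi _ (hint k)).sub (hphi _ hXinf_int)
    rw [integral_sub hs (hcint k), hcross,
      integral_sub (hphi _ (hint k)) (hphi _ hXinf_int), sub_zero]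
  have hDlim : Tendsto (fun k => ∫ ω, bregAux (X k ω) (Xinf ω) ∂ℙ) atTop (𝓝 0) := by
    rw [tendsto_order]
    refine ⟨fun a ha => Eventually.of_forall fun k =>
      ha.trans_le (integral_nonneg fun ω => (bregAux_key _ _).1), fun a ha => ?_⟩
    obtain ⟨n, hn⟩ := ((tailAux_tendsto (hint 0)).eventually_lt_const (half_pos ha)).exists
    set M : ℝ := n + 1
    have hM0 : 0 ≤ M := by positivity
    let f : BoundedContinuousFunction ℝ ℝ :=
      BoundedContinuousFunction.ofNormedAddCommGroup (fun x => min (√(1 + x ^ 2)) M)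
        (by fun_prop) M (fun x => by
          rw [Real.norm_eq_abs, abs_of_nonneg (le_min (Real.sqrt_nonneg _) hM0)]
          exact min_le_right _ _)
    have hf : ∀ x, f x = min (√(1 + x ^ 2)) M := fun x => rfl
    have hfint : ∀ Y : Ω → ℝ, Integrable Y ℙ → Integrable (fun ω => f (Y ω)) ℙ :=
      fun Y hY => (hphi Y hY).inf (integrable_const M)
    have hlt : ∫ ω, f (Xinf ω) ∂ℙ < ∫ ω, √(1 + Xinf ω ^ 2) ∂ℙ + a / 2 := by
      have : ∫ ω, f (Xinf ω) ∂ℙ ≤ ∫ ω, √(1 + Xinf ω ^ 2) ∂ℙ :=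
        integral_mono (hfint _ hXinf_int) (hphi _ hXinf_int) fun ω => min_le_left _ _
      linarith
    filter_upwards [(hweak f).eventually_lt_const hlt] with k hk
    rw [hDeq]
    have h1 : ∫ ω, √(1 + X k ω ^ 2) ∂ℙ ≤ ∫ ω, f (X k ω) ∂ℙ + ∫ ω, tailAux M (X k ω) ∂ℙ := by
      rw [← integral_add (hfint _ (hint k)) (tailAux_integrable M (hint k))]
      refine integral_mono (hphi _ (hint k))
        ((hfint _ (hint k)).add (tailAux_integrable M (hint k))) fun ω => ?_
      simp only [hf, tailAux]
      have h2 := sqrt_one_add_sq_le (X k ω)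
      rcases le_total (√(1 + X k ω ^ 2)) M with h | h
      · rw [min_eq_left h]
        linarith [le_max_right (|X k ω| + (1 - M)) 0]
      · rw [min_eq_right h]
        linarith [le_max_left (|X k ω| + (1 - M)) 0]
    linarith [htail M k]
  -- a subsequence along which the divergence converges to zero a.s.
  have hmeas : TendstoInMeasure ℙ (fun k ω => bregAux (X k ω) (Xinf ω)) atTop (fun _ => 0) := by
    refine tendstoInMeasure_of_tendsto_eLpNorm (p := 1) one_ne_zero
      (fun k => (hDint k).aestronglyMeasurable) aestronglyMeasurable_const ?_
    have h1 : Tendsto (fun k => ENNReal.ofReal (∫ ω, bregAux (X k ω) (Xinf ω) ∂ℙ)) atTop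
        (𝓝 0) := by simpa using ENNReal.tendsto_ofReal hDlim
    refine h1.congr fun k => ?_
    rw [eLpNorm_one_eq_lintegral_enorm]
    simp only [Pi.sub_apply, sub_zero]
    rw [← ofReal_integral_norm_eq_lintegral_enorm (hDint k)]
    congr 1
    refine integral_congr_ae (ae_of_all _ fun ω => ?_)
    simp only [Real.norm_eq_abs]
    rw [abs_of_nonneg (bregAux_key _ _).1]
  obtain ⟨ns, hns, hae⟩ := hmeas.exists_seq_tendsto_ae
  have hae' : ∀ᵐ ω ∂ℙ, Tendsto (fun i => X (ns i) ω) atTop (𝓝 (Xinf ω)) := by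
    filter_upwards [hae] with ω hω using bregAux_tendsto _ _ hω
  have hUI : UnifIntegrable (fun i => X (ns i)) 1 ℙ :=
    (((hint 0).uniformIntegrable_condExp (ℱ := fun i => G (ns i))
      (fun i => hGle _)).unifIntegrable).ae_eq (fun i => hmart 0 _ (Nat.zero_le _))
  have hsub := tendsto_Lp_finite_of_tendsto_ae le_rfl ENNReal.one_ne_top
    (fun i => (hint (ns i)).aestronglyMeasurable) (memLp_one_iff_integrable.2 hXinf_int) hUI hae'
  have hsubL : Tendsto (fun i => ∫ ω, |X (ns i) ω - Xinf ω| ∂ℙ) atTop (𝓝 0) := by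
    have h1 := (ENNReal.tendsto_toReal ENNReal.zero_ne_top).comp hsub
    rw [ENNReal.toReal_zero] at h1
    refine h1.congr fun i => ?_
    simp only [Function.comp_apply]
    rw [eLpNorm_one_eq_lintegral_enorm]
    simp only [Pi.sub_apply]
    rw [← ofReal_integral_norm_eq_lintegral_enorm (hZint (ns i)), ENNReal.toReal_ofReal]
    · rfl
    · exact integral_nonneg fun ω => norm_nonneg _
  -- the difference is a backward martingale
  have hZmart : ∀ k l, k ≤ l →
      ℙ[fun ω => X k ω - Xinf ω | G l] =ᵐ[ℙ] fun ω => X l ω - Xinf ω := by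
    intro k l hkl
    have h3 := condExp_of_stronglyMeasurable (hGle l) (hXinf_meas.mono (hGinf l)) hXinf_int
    filter_upwards [condExp_sub (hint k) hXinf_int (G l), hmart k l hkl] with ω h1 h2
    refine h1.trans ?_
    simp [h2, h3]
  have hanti : Antitone fun k => ∫ ω, |X k ω - Xinf ω| ∂ℙ := by
    intro k l hkl
    refine le_trans (le_of_eq ?_)
      (integral_abs_condExp_le (m := G l) (μ := ℙ) (fun ω => X k ω - Xinf ω))
    refine integral_congr_ae ?_
    filter_upwards [hZmart k l hkl] with ω h
    rw [h]
  have hL : Tendsto (fun k => ∫ ω, |X k ω - Xinf ω| ∂ℙ) atTop (𝓝 0) :=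
    (tendsto_iff_tendsto_subseq_of_antitone hanti hns.tendsto_atTop).2 hsubL
  refine ⟨?_, hL⟩
  have := aeAux G hGanti hGle (fun k ω => X k ω - Xinf ω)
    (fun k => (hadapt k).sub (hXinf_meas.mono (hGinf k))) hZint hZmart hL
  filter_upwards [this] with ω hω
  exact tendsto_sub_nhds_zero_iff.1 hω
end
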